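/- arXiv:1611.03280 — 3 statements merged into one kernel-verified Lean document; each statement's English description precedes it below -/
import Mathlib

section
/- Let R be a commutative noetherian ring, p a prime ideal of R, and M an R-module. If Tor_n^R(k(p), M) = 0 for some integer n ≥ dim R_p (the Krull dimension of the localization R_p), then Tor_i^R(k(p), M) = 0 for all i ≥ n. -/
open CategoryTheory Opposite

noncomputable section

/-- The `n`-th Ext group of `R`-modules `X` and `M`, i.e. `Ext^n_R(X, M)`. -/
def extModule (R : Type) [CommRing R] (n : ℕ) (X M : ModuleCat R) : ModuleCat R :=
  ((Ext R (ModuleCat R) n).obj (op X)).obj M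

/-- The `n`-th Tor group of `R`-modules `X` and `M`, i.e. `Tor_n^R(X, M)`. -/
def torModule (R : Type) [CommRing R] (n : ℕ) (X M : ModuleCat R) : ModuleCat R :=
  ((Tor (ModuleCat R) n).obj X).obj M

/-- The residue field `k(p) = R_p / p R_p` at a prime ideal `p`. -/
abbrev resField (R : Type) [CommRing R] (p : Ideal R) [p.IsPrime] : Type :=
  IsLocalRing.ResidueField (Localization.AtPrime p)



section InjectiveModules

variable {S : Type} [CommRing S]

/-- A map into an injective module extends along any map whose kernel it kills. -/
theorem Module.Injective.exists_extension_of_ker_le {I : Type} [AddCommGroup I] [Module S I]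
    (hI : Module.Injective S I) {X Y : Type} [AddCommGroup X] [Module S X]
    [AddCommGroup Y] [Module S Y] (f : X →ₗ[S] Y) (g : X →ₗ[S] I)
    (h : LinearMap.ker f ≤ LinearMap.ker g) : ∃ e : Y →ₗ[S] I, ∀ x, e (f x) = g x := by
  obtain ⟨e, he⟩ := hI.out ((LinearMap.ker f).liftQ f le_rfl)
    (LinearMap.ker_eq_bot.mp (Submodule.ker_liftQ_eq_bot _ _ _ le_rfl))
    ((LinearMap.ker f).liftQ g h)
  exact ⟨e, fun x => by simpa using he ((LinearMap.ker f).mkQ x)⟩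

/-- Over a noetherian ring, an element of an injective module is divisible by every power
of `x` up to `x`-power torsion, without shrinking its annihilator. -/
theorem Module.Injective.exists_pow_smul_sub_eq_zero [IsNoetherianRing S] {I : Type}
    [AddCommGroup I] [Module S I] (hI : Module.Injective S I) (x : S) (k : ℕ) (a : I) :
    ∃ (b : I) (m : ℕ), x ^ m • (x ^ k • b - a) = 0 ∧ ∀ c : S, c • a = 0 → c • b = 0 := by
  let N : ℕ →o Submodule S S :=
    { toFun := fun m => LinearMap.ker (LinearMap.toSpanSingleton S I (x ^ m • a))
      monotone' := by
        intro i j hij c hc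
        simp only [LinearMap.mem_ker, LinearMap.toSpanSingleton_apply] at hc ⊢
        obtain ⟨t, rfl⟩ := Nat.exists_eq_add_of_le' hij
        rw [pow_add, mul_smul, smul_comm, hc, smul_zero] }
  obtain ⟨m, hm⟩ := monotone_stabilizes_iff_noetherian.mpr (inferInstance : IsNoetherian S S) N
  let A := LinearMap.ker (LinearMap.toSpanSingleton S I a)
  obtain ⟨e, he⟩ := hI.exists_extension_of_ker_le
    (LinearMap.toSpanSingleton S (S ⧸ A) (x ^ (m + k) • A.mkQ 1))
    (LinearMap.toSpanSingleton S I (x ^ m • a)) (by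
      have : LinearMap.ker (LinearMap.toSpanSingleton S (S ⧸ A) (x ^ (m + k) • A.mkQ 1))
          ≤ N (m + k) := by
        intro c hc
        simp only [LinearMap.mem_ker, LinearMap.toSpanSingleton_apply, ← map_smul] at hc
        change _ = _
        rw [Submodule.mkQ_apply, Submodule.Quotient.mk_eq_zero] at hc
        simpa [A, mul_smul] using hc
      rw [← hm (m + k) (by omega)] at this
      exact this)
  refine ⟨e (A.mkQ 1), m, ?_, fun c hc => ?_⟩
  · have := he 1
    simp only [LinearMap.toSpanSingleton_apply, one_smul, map_smul] at this
    rw [smul_sub, ← mul_smul, ← pow_add, this, sub_self]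
  · rw [← map_smul, ← map_smul, Submodule.mkQ_apply,
      (Submodule.Quotient.mk_eq_zero A).mpr (by simpa [A] using hc), map_zero]

/-- Local cohomology of an injective resolution with respect to `x₁, …, x_d` vanishes
above degree `d`. -/
theorem exists_torsion_preimage [IsNoetherianRing S] (I : ℕ → Type)
    [∀ j, AddCommGroup (I j)] [∀ j, Module S (I j)] (hI : ∀ j, Module.Injective S (I j))
    (d : ∀ j, I j →ₗ[S] I (j + 1)) (hd : ∀ j, Function.Exact (d j) (d (j + 1)))
    (L : List S) : ∀ j, L.length ≤ j → ∀ z : I (j + 1), d (j + 1) z = 0 →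
      (∀ x ∈ L, ∃ r : ℕ, x ^ r • z = 0) →
      ∃ w : I j, d j w = z ∧ ∀ x ∈ L, ∃ r : ℕ, x ^ r • w = 0 := by
  induction L with
  | nil =>
    intro j _ z hz _
    obtain ⟨w, hw⟩ := (hd j z).mp hz
    exact ⟨w, hw, by simp⟩
  | cons x L ih =>
    intro j hj z hz hzL
    rw [List.length_cons] at hj
    obtain ⟨j, rfl⟩ := Nat.exists_eq_add_of_le' (show 1 ≤ j by omega)
    obtain ⟨w, rfl, hw⟩ := ih (j + 1) (by omega) z hz fun y hy => hzL y (by simp [hy])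
    obtain ⟨r, hr⟩ := hzL x (by simp)
    obtain ⟨v, hv, hvL⟩ := ih j (by omega) (x ^ r • w) (by rw [map_smul, hr]) fun y hy => by
      obtain ⟨s, hs⟩ := hw y hy
      exact ⟨s, by rw [smul_comm, hs, smul_zero]⟩
    obtain ⟨b, m, hb, hann⟩ := (hI j).exists_pow_smul_sub_eq_zero x r v
    refine ⟨w - d j b, ?_, ?_⟩
    · rw [map_sub, (hd j).apply_apply_eq_zero, sub_zero]
    · intro y hy
      rcases List.mem_cons.mp hy with rfl | hy
      · refine ⟨m + r, ?_⟩
        have := congrArg (d j) hb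
        rw [map_smul, map_sub, hv, map_smul, map_zero] at this
        rw [pow_add, mul_smul, smul_sub, ← neg_sub, smul_neg, this, neg_zero]
      · obtain ⟨s, hs⟩ := hw y hy
        obtain ⟨t, ht⟩ := hvL y hy
        refine ⟨s + t, ?_⟩
        have h1 : y ^ t • d j b = 0 := by rw [← map_smul, hann _ ht, map_zero]
        rw [smul_sub, pow_add, mul_smul, mul_smul, h1, smul_comm, hs, smul_zero, smul_zero,
          sub_zero]

/-- A linear map on a module killed by a maximal ideal `m` lifts through `a` as soon as each of
its values lifts to an `m`-torsion element. -/
theorem exists_lift_of_forall_torsion_lift (m : Ideal S) [m.IsMaximal] {V I I' : Type}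
    [AddCommGroup V] [Module S V] [AddCommGroup I] [Module S I] [AddCommGroup I'] [Module S I']
    (hV : ∀ c ∈ m, ∀ v : V, c • v = 0) (a : I' →ₗ[S] I) (φ : V →ₗ[S] I)
    (h : ∀ v, ∃ w, (∀ c ∈ m, c • w = 0) ∧ a w = φ v) :
    ∃ σ : V →ₗ[S] I', ∀ v, a (σ v) = φ v := by
  let := Ideal.Quotient.field m
  have hT : Module.IsTorsionBySet S V m := fun v c => hV c c.2 v
  let := hT.module
  have : IsScalarTower S (S ⧸ m) V := hT.isScalarTower
  choose w hw haw using h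
  let b := Module.Basis.ofVectorSpace (S ⧸ m) V
  let w' : V → Submodule.torsionBySet S I' m := fun v =>
    ⟨w v, (Submodule.mem_torsionBySet_iff _ _).mpr fun c => hw v c c.2⟩
  let σ := (b.constr (S ⧸ m) fun i => w' (b i)).restrictScalars S
  refine ⟨(Submodule.subtype _).comp σ, ?_⟩
  have key : a.comp ((Submodule.subtype _).comp σ) = φ := by
    refine LinearMap.ext_on_range (v := b) ?_ fun i => ?_
    · have := Submodule.restrictScalars_span S (S ⧸ m) Ideal.Quotient.mk_surjective (Set.range b)
      rw [← this, b.span_eq, Submodule.restrictScalars_top]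
    · have : σ (b i) = w' (b i) := b.constr_basis (S ⧸ m) _ i
      simp [this, w', haw]
  exact fun v => LinearMap.congr_fun key v

/-- If every `m`-torsion cocycle lifts to an `m`-torsion cochain, then the inclusion of any
submodule of cocycles killed by a power of `m` lifts to cochains. -/
theorem exists_section_on_torsion_cocycles (m : Ideal S) [m.IsMaximal] {I' I I'' : Type}
    [AddCommGroup I'] [Module S I'] [AddCommGroup I] [Module S I] [AddCommGroup I''] [Module S I'']
    (hI' : Module.Injective S I') (a : I' →ₗ[S] I) (b : I →ₗ[S] I'') (hab : ∀ w, b (a w) = 0)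
    (h : ∀ z, (∀ c ∈ m, c • z = 0) → b z = 0 → ∃ w, (∀ c ∈ m, c • w = 0) ∧ a w = z)
    (s : ℕ) : ∀ N : Submodule S I, (∀ c ∈ m ^ s, ∀ z ∈ N, c • z = 0) → (∀ z ∈ N, b z = 0) →
      ∃ g : I →ₗ[S] I', ∀ z ∈ N, a (g z) = z := by
  induction s with
  | zero =>
    intro N hN _
    refine ⟨0, fun z hz => ?_⟩
    have := hN 1 (by simp) z hz
    rw [one_smul] at this
    simp [this]
  | succ s ih =>
    intro N hN hbN
    obtain ⟨g, hg⟩ := ih (m • N) (by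
        intro c hc z hz
        refine Submodule.smul_induction_on hz (fun r hr n hn => ?_) fun x y hx hy => by
          rw [smul_add, hx, hy, add_zero]
        rw [← mul_smul]
        exact hN _ (pow_succ m s ▸ Ideal.mul_mem_mul hc hr) n hn)
      fun z hz => hbN z (Submodule.smul_le_right hz)
    let φ : N →ₗ[S] I := N.subtype - (a.comp g).comp N.subtype
    have hφ : m • (⊤ : Submodule S N) ≤ LinearMap.ker φ := by
      refine Submodule.smul_le.mpr fun c hc n _ => ?_
      have := hg (c • (n : I)) (Submodule.smul_mem_smul hc n.2)
      simp only [map_smul] at this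
      simp [φ, smul_sub, this]
    obtain ⟨σ, hσ⟩ := exists_lift_of_forall_torsion_lift m
      (V := N ⧸ (m • (⊤ : Submodule S N)))
      (by
        intro c hc v
        obtain ⟨n, rfl⟩ := Submodule.mkQ_surjective _ v
        rw [← map_smul, Submodule.mkQ_apply, Submodule.Quotient.mk_eq_zero]
        exact Submodule.smul_mem_smul hc trivial)
      a (Submodule.liftQ _ φ hφ) (by
        intro v
        obtain ⟨n, rfl⟩ := Submodule.mkQ_surjective _ v
        refine h _ (fun c hc => ?_) ?_
        · rw [← map_smul, ← map_smul, Submodule.mkQ_apply, Submodule.liftQ_apply]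
          exact hφ (Submodule.smul_mem_smul hc trivial)
        · simp [φ, hab, hbN n n.2])
    obtain ⟨e, he⟩ := hI'.out N.subtype N.injective_subtype
      (σ.comp (Submodule.mkQ _))
    refine ⟨g + e, fun z hz => ?_⟩
    have h1 := hσ (Submodule.mkQ _ ⟨z, hz⟩)
    have h2 := he ⟨z, hz⟩
    simp only [Submodule.subtype_apply, LinearMap.comp_apply] at h2
    rw [LinearMap.add_apply, map_add, h2, h1]
    simp [φ]

/-- If every `m`-torsion cocycle lifts to an `m`-torsion cochain, then an `m`-power torsion
element with `m`-torsion coboundary can be replaced by an `m`-torsion one. -/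
theorem exists_torsion_of_torsion_coboundary (m : Ideal S) [m.IsMaximal] {I' I I'' : Type}
    [AddCommGroup I'] [Module S I'] [AddCommGroup I] [Module S I] [AddCommGroup I''] [Module S I'']
    (hI' : Module.Injective S I') (a : I' →ₗ[S] I) (b : I →ₗ[S] I'') (hab : ∀ w, b (a w) = 0)
    (h : ∀ z, (∀ c ∈ m, c • z = 0) → b z = 0 → ∃ w, (∀ c ∈ m, c • w = 0) ∧ a w = z)
    (s : ℕ) (w : I) (hw : ∀ c ∈ m ^ s, c • w = 0) (hbw : ∀ c ∈ m, c • b w = 0) :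
    ∃ w', (∀ c ∈ m, c • w' = 0) ∧ b w' = b w := by
  obtain ⟨g, hg⟩ := exists_section_on_torsion_cocycles m hI' a b hab h s
    (m • Submodule.span S {w})
    (by
      intro c hc z hz
      obtain ⟨y, rfl⟩ := Submodule.mem_span_singleton.mp (Submodule.smul_le_right hz)
      rw [smul_comm, hw c hc, smul_zero])
    (by
      intro z hz
      refine Submodule.smul_induction_on hz (fun r hr n hn => ?_) fun x y hx hy => by
        rw [map_add, hx, hy, add_zero]
      obtain ⟨y, rfl⟩ := Submodule.mem_span_singleton.mp hn
      rw [smul_comm, map_smul, map_smul, hbw r hr, smul_zero])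
  refine ⟨w - a (g w), fun c hc => ?_, by rw [map_sub, hab, sub_zero]⟩
  have := hg (c • w) (Submodule.smul_mem_smul hc (Submodule.mem_span_singleton_self w))
  simp only [map_smul] at this
  rw [smul_sub, this, sub_self]

/-- A noetherian local ring of dimension at most `n` has at most `n` elements generating an ideal
such that torsion for them is torsion for a power of the maximal ideal. -/
theorem IsLocalRing.exists_list_forall_torsion [IsNoetherianRing S] [IsLocalRing S] (n : ℕ)
    (hn : ringKrullDim S ≤ (n : WithBot (WithTop ℕ))) :
    ∃ L : List S, L.length ≤ n ∧ (∀ x ∈ L, x ∈ maximalIdeal S) ∧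
      ∀ (I : Type) [AddCommGroup I] [Module S I] (z : I), (∀ x ∈ L, ∃ r : ℕ, x ^ r • z = 0) →
        ∃ s : ℕ, ∀ c ∈ maximalIdeal S ^ s, c • z = 0 := by
  obtain ⟨F, hF, hcard⟩ :=
    (maximalIdeal S).exists_finset_card_eq_height_of_isNoetherianRing
  rw [← maximalIdeal_height_eq_ringKrullDim, ← hcard] at hn
  refine ⟨F.toList, ?_, ?_, ?_⟩
  · rw [Finset.length_toList]
    have hn' : ((F.card : ℕ∞) : WithBot ℕ∞) ≤ ((n : ℕ∞) : WithBot ℕ∞) := hn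
    exact_mod_cast hn'
  · intro x hx
    exact hF.1.2 (Ideal.subset_span (by simpa using hx))
  · intro I _ _ z hz
    let A : Ideal S := LinearMap.ker (LinearMap.toSpanSingleton S I z)
    have hFA : Ideal.span (F : Set S) ≤ A.radical := by
      refine Ideal.span_le.mpr fun x hx => ?_
      obtain ⟨r, hr⟩ := hz x (by simpa using hx)
      exact ⟨r, by simpa [A] using hr⟩
    have hmA : maximalIdeal S ≤ A.radical := by
      rw [Ideal.radical_eq_sInf]
      refine le_sInf fun q ⟨hAq, hq⟩ => ?_
      exact hF.2 ⟨hq, hFA.trans (hq.radical_le_iff.mpr hAq)⟩ (le_maximalIdeal hq.ne_top)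
    obtain ⟨s, hs⟩ := Ideal.exists_pow_le_of_le_radical_of_fg hmA
      (IsNoetherian.noetherian _)
    exact ⟨s, fun c hc => by simpa [A] using hs hc⟩

end InjectiveModules

section CharacterModules

/-- A sequence is exact if and only if its character dual is. -/
theorem CharacterModule.dual_exact_iff {R : Type} [CommRing R] {X Y Z : Type} [AddCommGroup X]
    [Module R X] [AddCommGroup Y] [Module R Y] [AddCommGroup Z] [Module R Z]
    (g : X →ₗ[R] Y) (f : Y →ₗ[R] Z) :
    Function.Exact (dual f) (dual g) ↔ Function.Exact g f := by
  constructor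
  · intro h y
    constructor
    · intro hy
      by_contra hyg
      have hne : (LinearMap.range g).mkQ y ≠ 0 := by
        rwa [Ne, Submodule.mkQ_apply, Submodule.Quotient.mk_eq_zero]
      obtain ⟨χ, hχ⟩ := exists_character_apply_ne_zero_of_ne_zero hne
      obtain ⟨ψ, hψ⟩ := (h (dual (LinearMap.range g).mkQ χ)).mp (by
        ext x
        change χ ((LinearMap.range g).mkQ (g x)) = 0
        rw [Submodule.mkQ_apply, (Submodule.Quotient.mk_eq_zero _).mpr (LinearMap.mem_range_self g x),
          map_zero])
      apply hχ
      change dual (LinearMap.range g).mkQ χ y = 0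
      rw [← hψ]
      change ψ (f y) = 0
      rw [hy, map_zero]
    · rintro ⟨x, rfl⟩
      refine eq_zero_of_character_apply fun ψ => ?_
      have := h.apply_apply_eq_zero ψ
      exact DFunLike.congr_fun this x
  · intro h χ
    constructor
    · intro hχ
      let χ' : CharacterModule (Y ⧸ LinearMap.range g) :=
        QuotientAddGroup.lift (LinearMap.range g).toAddSubgroup χ (by
          rintro _ ⟨x, rfl⟩
          exact DFunLike.congr_fun hχ x)
      have hle : LinearMap.range g ≤ LinearMap.ker f := by
        rw [h.linearMap_ker_eq]
      obtain ⟨ψ, hψ⟩ := dual_surjective_of_injective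
        ((LinearMap.range g).liftQ f hle)
        (LinearMap.ker_eq_bot.mp
          (Submodule.ker_liftQ_eq_bot _ _ _ h.linearMap_ker_eq.le)) χ'
      refine ⟨ψ, ?_⟩
      ext y
      exact DFunLike.congr_fun hψ ((LinearMap.range g).mkQ y)
    · rintro ⟨ψ, rfl⟩
      ext x
      change ψ (f (g x)) = 0
      rw [h.apply_apply_eq_zero, map_zero]

open TensorProduct IsLocalRing

variable (R S : Type) [CommRing R] [CommRing S] [IsLocalRing S] [Algebra R S]

/-- The reduction map from `S ⊗ X` to `k ⊗ X`, where `k` is the residue field of `S`. -/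
def residueTensor (X : Type) [AddCommGroup X] [Module R X] :
    S ⊗[R] X →ₗ[R] ResidueField S ⊗[R] X :=
  LinearMap.rTensor X (IsScalarTower.toAlgHom R S (ResidueField S)).toLinearMap

theorem residueTensor_surjective (X : Type) [AddCommGroup X] [Module R X] :
    Function.Surjective (residueTensor R S X) :=
  LinearMap.rTensor_surjective X residue_surjective

variable {R S} in
theorem residueTensor_baseChange {X Y : Type} [AddCommGroup X] [Module R X]
    [AddCommGroup Y] [Module R Y] (f : X →ₗ[R] Y) (t : S ⊗[R] X) :
    residueTensor R S Y (f.baseChange S t) =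
      f.lTensor (ResidueField S) (residueTensor R S X t) := by
  induction t with
  | zero => simp
  | add x y hx hy => simp only [map_add, hx, hy]
  | tmul s x => simp [residueTensor]

/-- The characters of `k ⊗ X` are the characters of `S ⊗ X` killed by the maximal ideal. -/
theorem exists_dual_residueTensor_eq_iff (X : Type) [AddCommGroup X] [Module R X]
    (χ : CharacterModule (S ⊗[R] X)) :
    (∃ ψ, CharacterModule.dual (residueTensor R S X) ψ = χ) ↔
      ∀ c ∈ maximalIdeal S, c • χ = 0 := by
  let m : Submodule R S := (maximalIdeal S).restrictScalars R
  have hex : Function.Exact (CharacterModule.dual (residueTensor R S X))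
      (CharacterModule.dual (A := m ⊗[R] X) (m.subtype.rTensor X)) := by
    refine (CharacterModule.dual_exact_iff (X := m ⊗[R] X) (m.subtype.rTensor X) (residueTensor R S X)).mpr ?_
    refine rTensor_exact X (fun s => ?_) residue_surjective
    change residue S s = 0 ↔ _
    simp [m]
  rw [← Set.mem_range, ← hex χ]
  constructor
  · intro h c hc
    ext t
    rw [CharacterModule.smul_apply]
    induction t with
    | zero => simp
    | add x y hx hy => rw [smul_add, map_add, hx, hy]; simp
    | tmul s x =>
      have := DFunLike.congr_fun h ((⟨c * s, Ideal.mul_mem_right s _ hc⟩ : m) ⊗ₜ[R] x)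
      rw [TensorProduct.smul_tmul', smul_eq_mul]
      exact this
  · intro h
    ext t
    induction t with
    | zero => exact (map_zero _).trans (map_zero _).symm
    | add x y hx hy => rw [map_add, hx, hy]; simp
    | tmul s x =>
      have := DFunLike.congr_fun (h s s.2) (1 ⊗ₜ[R] x)
      rw [CharacterModule.smul_apply, TensorProduct.smul_tmul', smul_eq_mul, mul_one] at this
      exact this

/-- Exactness after tensoring with the residue field, in terms of characters. -/
theorem lTensor_residueField_exact_iff {X Y Z : Type} [AddCommGroup X]
    [Module R X] [AddCommGroup Y] [Module R Y] [AddCommGroup Z] [Module R Z]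
    (g : X →ₗ[R] Y) (f : Y →ₗ[R] Z) (hfg : ∀ x, f (g x) = 0) :
    Function.Exact (g.lTensor (ResidueField S)) (f.lTensor (ResidueField S)) ↔
      ∀ z : CharacterModule (S ⊗[R] Y), (∀ c ∈ maximalIdeal S, c • z = 0) →
        CharacterModule.dual (g.baseChange S) z = 0 →
        ∃ w : CharacterModule (S ⊗[R] Z), (∀ c ∈ maximalIdeal S, c • w = 0) ∧
          CharacterModule.dual (f.baseChange S) w = z := by
  have nat : ∀ {A B : Type} [AddCommGroup A] [Module R A] [AddCommGroup B] [Module R B]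
      (f : A →ₗ[R] B) (ψ : CharacterModule (ResidueField S ⊗[R] B)),
      CharacterModule.dual (f.baseChange S) (CharacterModule.dual (residueTensor R S B) ψ) =
        CharacterModule.dual (residueTensor R S A)
          (CharacterModule.dual (f.lTensor (ResidueField S)) ψ) := by
    intro A B _ _ _ _ f ψ
    ext t
    exact congrArg ψ (residueTensor_baseChange f t)
  have inj : ∀ (A : Type) [AddCommGroup A] [Module R A],
      Function.Injective (CharacterModule.dual (residueTensor R S A)) := fun A _ _ =>
    CharacterModule.dual_injective_of_surjective _ (residueTensor_surjective R S A)
  rw [← CharacterModule.dual_exact_iff]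
  simp only [← exists_dual_residueTensor_eq_iff]
  constructor
  · rintro h _ ⟨ψ, rfl⟩ hψ
    rw [nat, ← map_zero (CharacterModule.dual (residueTensor R S X))] at hψ
    obtain ⟨w, rfl⟩ := (h ψ).mp (inj _ hψ)
    exact ⟨_, ⟨w, rfl⟩, nat f w⟩
  · intro h ψ
    constructor
    · intro hψ
      obtain ⟨_, ⟨w, rfl⟩, hw⟩ := h _ ⟨ψ, rfl⟩ (by rw [nat, hψ, map_zero])
      exact ⟨w, inj _ (by rw [← nat, hw])⟩
    · rintro ⟨w, rfl⟩
      have h0 : f.comp g = 0 := LinearMap.ext hfg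
      rw [← LinearMap.comp_apply, ← CharacterModule.dual_comp, ← LinearMap.lTensor_comp, h0,
        LinearMap.lTensor_zero, CharacterModule.dual_zero, LinearMap.zero_apply]

end CharacterModules

section Tor

open TensorProduct

/-- `Tor` with the first argument fixed, computed by a projective resolution of the second. -/
theorem subsingleton_torModule_iff (R : Type) [CommRing R] (X : Type) [AddCommGroup X] [Module R X]
    {M : ModuleCat R} (P : ProjectiveResolution M) (i : ℕ) :
    Subsingleton (torModule R i (ModuleCat.of R X) M) ↔
      Function.Exact ((P.complex.d (i + 1) i).hom.lTensor X)
        ((P.complex.d i ((ComplexShape.down ℕ).next i)).hom.lTensor X) := by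
  let F := (MonoidalCategory.tensoringLeft (ModuleCat R)).obj (ModuleCat.of R X)
  rw [← ModuleCat.isZero_iff_subsingleton]
  have e : torModule R i (ModuleCat.of R X) M ≅
      ((F.mapHomologicalComplex _).obj P.complex).homology i := P.isoLeftDerivedObj F i
  rw [e.isZero_iff, ← HomologicalComplex.exactAt_iff_isZero_homology,
    HomologicalComplex.exactAt_iff' _ (i + 1) i _ (by simp) rfl,
    ShortComplex.moduleCat_exact_iff_range_eq_ker, eq_comm, ← LinearMap.exact_iff]
  rfl

/-- If `Tor_n^R(k(p), M) = 0` for some `n ≥ dim R_p`, then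
`Tor_i^R(k(p), M) = 0` for all `i ≥ n`. -/
theorem tor_residueField_rigidity
    (R : Type) [CommRing R] [IsNoetherianRing R] (p : Ideal R) [p.IsPrime]
    (M : Type) [AddCommGroup M] [Module R M] (n : ℕ)
    (hn : ringKrullDim (Localization.AtPrime p) ≤ (n : WithBot (WithTop ℕ)))
    (hvan : Subsingleton
      (torModule R n (ModuleCat.of R (resField R p)) (ModuleCat.of R M))) :
    ∀ i : ℕ, n ≤ i →
      Subsingleton (torModule R i (ModuleCat.of R (resField R p)) (ModuleCat.of R M)) := by
  let S := Localization.AtPrime p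
  have : IsNoetherianRing S := IsLocalization.isNoetherianRing p.primeCompl S inferInstance
  have : Module.Flat R S := IsLocalization.flat S p.primeCompl
  let P := projectiveResolution (ModuleCat.of R M)
  obtain ⟨L, hLn, hLm, hL⟩ := IsLocalRing.exists_list_forall_torsion (S := S) n hn
  have hinj : ∀ j, Module.Injective S (CharacterModule (S ⊗[R] P.complex.X j)) := fun j => by
    have : Module.Projective R (P.complex.X j) :=
      (IsProjective.iff_projective _).mpr (inferInstance : Projective (P.complex.X j))
    exact Module.Flat.iff_characterModule_injective.mp inferInstance
  let d (i j : ℕ) := CharacterModule.dual ((P.complex.d i j).hom.baseChange S)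
  have hdd : ∀ i j k (w : CharacterModule (S ⊗[R] P.complex.X k)),
      d i j (d j k w) = 0 := fun i j k w => by
    rw [← LinearMap.comp_apply, ← CharacterModule.dual_comp, ← LinearMap.baseChange_comp,
      ← ModuleCat.hom_comp, P.complex.d_comp_d]
    simp
  have hex : ∀ j, Function.Exact (d (j + 1) j) (d (j + 2) (j + 1)) := fun j => by
    rw [CharacterModule.dual_exact_iff]
    exact Module.Flat.lTensor_exact S
      (LinearMap.exact_iff.mpr
        ((ShortComplex.moduleCat_exact_iff_range_eq_ker _).mp (P.exact_succ j)).symm)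
  intro i hi
  induction i, hi using Nat.le_induction with
  | base => exact hvan
  | succ i hi ih =>
    rw [subsingleton_torModule_iff _ _ P, lTensor_residueField_exact_iff _ _ _ _ (fun x => by
      rw [← LinearMap.comp_apply, ← ModuleCat.hom_comp, P.complex.d_comp_d]; rfl)] at ih ⊢
    rw [ChainComplex.next_nat_succ]
    intro z hz hdz
    obtain ⟨w, rfl, hw⟩ := exists_torsion_preimage
      (fun j => CharacterModule (S ⊗[R] P.complex.X j)) hinj (fun j => d (j + 1) j) hex L i
      (hLn.trans hi) z hdz fun x hx => ⟨1, by rw [pow_one]; exact hz x (hLm x hx)⟩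
    obtain ⟨s, hs⟩ := hL _ w hw
    exact exists_torsion_of_torsion_coboundary (IsLocalRing.maximalIdeal S) (hinj _)
      (d i _) (d (i + 1) i) (hdd _ _ _) ih s w hs hz

end Tor
end
end

section
/- Let R be a commutative noetherian ring, p a prime ideal of R, and M an R-module. If Ext^n_{R_p}(k(p), M_p) = 0 for some integer n ≥ dim R_p, then Ext^i_{R_p}(k(p), M_p) = 0 for all i ≥ n. -/
open CategoryTheory Opposite

noncomputable section

universe u

section

variable {R : Type u} [CommRing R]

/-- Every element of `s` acts nilpotently on `N`. -/
def ActsNilpotently (s : Finset R) (N : Type u) [AddCommGroup N] [Module R N] : Prop :=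
  ∀ x ∈ s, ∃ t : ℕ, ∀ y : N, x ^ t • y = 0

namespace ActsNilpotently

variable {s : Finset R} {N P : Type u} [AddCommGroup N] [Module R N] [AddCommGroup P] [Module R P]

lemma of_injective (h : ActsNilpotently s P) (f : N →ₗ[R] P) (hf : Function.Injective f) :
    ActsNilpotently s N := fun x hx ↦ by
  obtain ⟨t, ht⟩ := h x hx
  exact ⟨t, fun y ↦ hf (by simp [ht])⟩

lemma of_surjective (h : ActsNilpotently s N) (f : N →ₗ[R] P) (hf : Function.Surjective f) :
    ActsNilpotently s P := fun x hx ↦ by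
  obtain ⟨t, ht⟩ := h x hx
  refine ⟨t, fun y ↦ ?_⟩
  obtain ⟨z, rfl⟩ := hf y
  rw [← map_smul, ht, map_zero]

lemma prod (hN : ActsNilpotently s N) (hP : ActsNilpotently s P) :
    ActsNilpotently s (N × P) := fun x hx ↦ by
  obtain ⟨t, ht⟩ := hN x hx
  obtain ⟨r, hr⟩ := hP x hx
  refine ⟨t + r, fun y ↦ Prod.ext ?_ ?_⟩
  · rw [pow_add, mul_comm, mul_smul]
    simp [ht]
  · simp [pow_add, mul_smul, hr]

end ActsNilpotently

/-- For `x` acting on a Noetherian module, the kernels of the powers of `x` stabilize. -/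
lemma exists_pow_smul_eq_zero_imp [IsNoetherianRing R] (x : R) (N : Type u) [AddCommGroup N]
    [Module R N] [Module.Finite R N] :
    ∃ n : ℕ, ∀ m (y : N), x ^ m • y = 0 → x ^ n • y = 0 := by
  obtain ⟨n, hn⟩ := monotone_stabilizes_iff_noetherian.mpr (inferInstance : IsNoetherian R N)
    ⟨fun k ↦ LinearMap.ker (LinearMap.lsmul R N (x ^ k)), monotone_nat_of_le_succ fun k y hy ↦ by
      simp_all [pow_succ', mul_smul]⟩
  refine ⟨n, fun m y hy ↦ ?_⟩
  have h : y ∈ LinearMap.ker (LinearMap.lsmul R N (x ^ (n + m))) := by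
    simp [pow_add, mul_smul, hy]
  have e := hn (n + m) (Nat.le_add_right n m)
  simp only [OrderHom.coe_mk] at e
  rw [← e] at h
  simpa using h

/-- The short complex `N / ker f → P → P / range f`. -/
abbrev rangeShortComplex {N P : ModuleCat.{u} R} (f : N ⟶ P) : ShortComplex (ModuleCat.{u} R) :=
  .mk (X₁ := .of R (N ⧸ LinearMap.ker f.hom)) (X₃ := .of R (P ⧸ LinearMap.range f.hom))
    (ModuleCat.ofHom ((LinearMap.ker f.hom).liftQ f.hom le_rfl))
    (ModuleCat.ofHom (LinearMap.range f.hom).mkQ) (by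
      ext y
      simp)

lemma rangeShortComplex_shortExact {N P : ModuleCat.{u} R} (f : N ⟶ P) :
    (rangeShortComplex f).ShortExact where
  exact := (ShortComplex.ShortExact.moduleCat_exact_iff_function_exact _).mpr (by
    rw [LinearMap.exact_iff]
    simp [Submodule.range_liftQ])
  mono_f := (ModuleCat.mono_iff_injective _).mpr
    (LinearMap.ker_eq_bot.mp (Submodule.ker_liftQ_eq_bot _ _ _ le_rfl))
  epi_g := (ModuleCat.epi_iff_surjective _).mpr (Submodule.mkQ_surjective _)

/-- Above degree `s.card`, Ext classes on modules on which `s` acts nilpotently are effaceable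
by modules of the same kind. This amounts to the vanishing of local cohomology in these degrees. -/
theorem exists_epi_comp_ext_eq_zero [IsNoetherianRing R] (M : ModuleCat.{u} R) (s : Finset R) :
    ∀ (N : ModuleCat.{u} R) [Module.Finite R N] (_ : ActsNilpotently s N) (i : ℕ)
      (_ : s.card < i) (ξ : Abelian.Ext N M i),
      ∃ (L : ModuleCat.{u} R) (f : L ⟶ N), Module.Finite R L ∧ ActsNilpotently s L ∧
        Function.Surjective f.hom ∧ (Abelian.Ext.mk₀ f).comp ξ (zero_add i) = 0 := by
  classical
  induction s using Finset.induction_on with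
  | empty =>
    intro N _ _ i hi ξ
    obtain ⟨n, f, hf⟩ := Module.Finite.exists_fin' R N
    obtain ⟨j, rfl⟩ := Nat.exists_eq_succ_of_ne_zero (Nat.ne_of_gt hi)
    have : Projective (ModuleCat.of R (Fin n → R)) :=
      ModuleCat.projective_of_free (Pi.basisFun R (Fin n))
    exact ⟨.of R (Fin n → R), ModuleCat.ofHom f, inferInstanceAs (Module.Finite R (Fin n → R)),
      fun x hx ↦ by simp at hx, hf, Abelian.Ext.eq_zero_of_projective _⟩
  | insert a s ha ih =>
    intro N _ hN i hi ξ
    rw [Finset.card_insert_of_notMem ha] at hi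
    obtain ⟨j, rfl⟩ : ∃ j, i = 1 + j := ⟨i - 1, by lia⟩
    obtain ⟨t, ht⟩ := hN a (Finset.mem_insert_self a s)
    obtain ⟨L, p, _, hL, hp, hξ⟩ := ih N (fun x hx ↦ hN x (Finset.mem_insert_of_mem hx)) (1 + j)
      (by lia) ξ
    have hK := LinearMap.shortExact_shortComplexKer hp
    obtain ⟨η, rfl⟩ := Abelian.Ext.contravariant_sequence_exact₃ hK M ξ hξ rfl
    obtain ⟨P, h, _, hP, hh, hη⟩ := ih (.of R (LinearMap.ker p.hom))
      (hL.of_injective _ (Submodule.injective_subtype _)) j (by lia) η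
    -- `Q` is the fibre product of `P` and `L` over `ker p` along `h` and multiplication by `a ^ t`
    let Q : Submodule R (L × P) := LinearMap.eqLocus (a ^ t • LinearMap.fst R L P)
      ((LinearMap.ker p.hom).subtype ∘ₗ h.hom ∘ₗ LinearMap.snd R L P)
    let q : Q →ₗ[R] L := LinearMap.fst R L P ∘ₗ Q.subtype
    let g : Q →ₗ[R] P := LinearMap.snd R L P ∘ₗ Q.subtype
    have hqg (z : Q) : a ^ t • q z = (h.hom (g z) : LinearMap.ker p.hom).1 := z.2
    have hq : Function.Surjective q := fun y ↦ by
      obtain ⟨z, hz⟩ := hh ⟨a ^ t • y, by simp [ht]⟩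
      exact ⟨⟨(y, z), (congrArg Subtype.val hz).symm⟩, rfl⟩
    obtain ⟨m, hm⟩ := exists_pow_smul_eq_zero_imp a Q
    let φ : ModuleCat.of R Q ⟶ ModuleCat.of R Q :=
      ModuleCat.ofHom (LinearMap.lsmul R Q (a ^ (m + t)))
    let g' : ModuleCat.of R (Q ⧸ LinearMap.ker φ.hom) ⟶ P :=
      ModuleCat.ofHom ((LinearMap.ker φ.hom).liftQ (a ^ m • g) fun z hz ↦ by
        have := hm (m + t) z hz
        rw [LinearMap.mem_ker, LinearMap.smul_apply, ← map_smul, this, map_zero])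
    let r : ModuleCat.of R (Q ⧸ LinearMap.range φ.hom) ⟶ N :=
      ModuleCat.ofHom ((LinearMap.range φ.hom).liftQ (p.hom ∘ₗ q) (by
        rintro _ ⟨z, rfl⟩
        simp [φ, pow_add, mul_smul, ht]))
    let τ : rangeShortComplex φ ⟶ p.hom.shortComplexKer :=
      ShortComplex.homMk (g' ≫ h) (ModuleCat.ofHom q) r
        (by
          ext z
          simp [g', φ, pow_add, mul_smul, hqg])
        (by ext z; rfl)
    refine ⟨_, r, inferInstanceAs (Module.Finite R (Q ⧸ LinearMap.range φ.hom)), ?_, ?_, ?_⟩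
    · intro x hx
      obtain rfl | hx := Finset.mem_insert.mp hx
      · refine ⟨m + t, fun z ↦ ?_⟩
        obtain ⟨z, rfl⟩ := Submodule.mkQ_surjective _ z
        rw [← map_smul, Submodule.mkQ_apply, Submodule.Quotient.mk_eq_zero]
        exact ⟨z, rfl⟩
      · exact ((hL.prod hP).of_injective Q.subtype Q.injective_subtype).of_surjective
          (LinearMap.range φ.hom).mkQ (Submodule.mkQ_surjective _) x hx
    · intro y
      obtain ⟨y, rfl⟩ := hp y
      obtain ⟨z, rfl⟩ := hq y
      exact ⟨Submodule.Quotient.mk z, rfl⟩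
    · have hτ := ShortComplex.ShortExact.extClass_naturality (rangeShortComplex_shortExact φ) hK τ
      have : (Abelian.Ext.mk₀ τ.τ₃).comp (hK.extClass.comp η rfl) (zero_add _) = 0 := by
        rw [← Abelian.Ext.comp_assoc (a₁₂ := 1) _ _ _ (by lia) (by lia) (by lia), ← hτ,
          Abelian.Ext.comp_assoc (a₂₃ := j) _ _ _ (by lia) (by lia) (by lia)]
        have : (Abelian.Ext.mk₀ τ.τ₁).comp η (zero_add j) = 0 := by
          change (Abelian.Ext.mk₀ (g' ≫ h)).comp η (zero_add j) = 0
          rw [← Abelian.Ext.mk₀_comp_mk₀_assoc, hη, Abelian.Ext.comp_zero]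
        rw [this, Abelian.Ext.comp_zero]
      exact this

/-- If `s` generates an ideal primary to the maximal ideal and `Ext^n(k, M) = 0`, then
`Ext^n(L, M) = 0` for every finitely generated `L` on which `s` acts nilpotently. -/
lemma subsingleton_ext_of_actsNilpotently [IsNoetherianRing R] [IsLocalRing R]
    (M : ModuleCat.{u} R) (s : Finset R)
    (hs : IsLocalRing.maximalIdeal R ∈ (Ideal.span (s : Set R)).minimalPrimes) (n : ℕ)
    (h : Subsingleton (Abelian.Ext (ModuleCat.of R (IsLocalRing.ResidueField R)) M n))
    (L : Type u) [AddCommGroup L] [Module R L] [hL : Module.Finite R L]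
    (hLs : ActsNilpotently s L) : Subsingleton (Abelian.Ext (ModuleCat.of R L) M n) := by
  induction hL using IsNoetherianRing.induction_on_isQuotientEquivQuotientPrime R with
  | subsingleton N =>
    have hN : Limits.IsZero (ModuleCat.of R N) := ModuleCat.isZero_of_subsingleton _
    refine subsingleton_of_forall_eq 0 fun ξ ↦ ?_
    rw [← Abelian.Ext.mk₀_id_comp ξ, hN.eq_of_src (𝟙 _) 0, Abelian.Ext.mk₀_zero,
      Abelian.Ext.zero_comp]
  | quotient N p e =>
    have hsp : Ideal.span (s : Set R) ≤ p.1 := Ideal.span_le.mpr fun x hx ↦ by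
      obtain ⟨t, ht⟩ := hLs x hx
      have := congrArg e (ht (e.symm 1))
      rw [map_smul, LinearEquiv.apply_symm_apply, map_zero] at this
      refine p.2.mem_of_pow_mem t ?_
      rw [← Ideal.Quotient.eq_zero_iff_mem]
      simpa [Algebra.smul_def] using this
    have hp : p.1 = IsLocalRing.maximalIdeal R :=
      le_antisymm (IsLocalRing.le_maximalIdeal p.2.ne_top)
        (hs.2 ⟨p.2, hsp⟩ (IsLocalRing.le_maximalIdeal p.2.ne_top))
    let e' : N ≃ₗ[R] IsLocalRing.ResidueField R := e.trans (Submodule.quotEquivOfEq _ _ hp)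
    let f := e'.toModuleIso
    refine subsingleton_of_forall_eq 0 fun ξ ↦ ?_
    rw [← Abelian.Ext.mk₀_id_comp ξ, ← f.hom_inv_id, ← Abelian.Ext.mk₀_comp_mk₀_assoc,
      Subsingleton.elim ((Abelian.Ext.mk₀ f.inv).comp ξ (zero_add n)) 0, Abelian.Ext.comp_zero]
  | exact N₁ N₂ N₃ f g hf hg hfg h₁ h₃ =>
    have := h₁ (hLs.of_injective f hf)
    have := h₃ (hLs.of_surjective g hg)
    let S : ShortComplex (ModuleCat.{u} R) := .mk (ModuleCat.ofHom f) (ModuleCat.ofHom g)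
      (by ext y; exact hfg.apply_apply_eq_zero y)
    have hS := ModuleCat.shortComplex_shortExact S hfg hf hg
    refine subsingleton_of_forall_eq 0 fun ξ ↦ ?_
    obtain ⟨ζ, rfl⟩ := Abelian.Ext.contravariant_sequence_exact₂ hS M ξ (Subsingleton.elim _ _)
    rw [Subsingleton.elim ζ 0, Abelian.Ext.comp_zero]

theorem subsingleton_ext_residueField_of_le [IsNoetherianRing R] [IsLocalRing R]
    (M : ModuleCat.{u} R) (n : ℕ) (hn : ringKrullDim R ≤ n)
    (h : Subsingleton (Abelian.Ext (ModuleCat.of R (IsLocalRing.ResidueField R)) M n))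
    (i : ℕ) (hi : n ≤ i) :
    Subsingleton (Abelian.Ext (ModuleCat.of R (IsLocalRing.ResidueField R)) M i) := by
  obtain ⟨s, hs, hcard⟩ :=
    (IsLocalRing.maximalIdeal R).exists_finset_card_eq_height_of_isNoetherianRing
  have hsn : s.card ≤ n := by
    rw [← IsLocalRing.maximalIdeal_height_eq_ringKrullDim, ← hcard] at hn
    exact_mod_cast hn
  induction i, hi using Nat.le_induction with
  | base => exact h
  | succ i hi ih =>
    refine subsingleton_of_forall_eq 0 fun ξ ↦ ?_
    have hk : ActsNilpotently s (IsLocalRing.ResidueField R) := fun x hx ↦ ⟨1, fun y ↦ by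
      have : algebraMap R (IsLocalRing.ResidueField R) x = 0 :=
        (IsLocalRing.residue_eq_zero_iff x).mpr (hs.1.2 (Ideal.subset_span hx))
      rw [pow_one, Algebra.smul_def, this, zero_mul]⟩
    have : Module.Finite R (IsLocalRing.ResidueField R) :=
      .of_surjective (Algebra.linearMap R _) IsLocalRing.residue_surjective
    obtain ⟨L, f, _, hL, hf, hξ⟩ := exists_epi_comp_ext_eq_zero M s
      (.of R (IsLocalRing.ResidueField R)) hk (i + 1) (by lia) ξ
    obtain ⟨η, rfl⟩ := Abelian.Ext.contravariant_sequence_exact₃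
      (LinearMap.shortExact_shortComplexKer hf) M ξ hξ (add_comm 1 i)
    have := subsingleton_ext_of_actsNilpotently M s hs i ih (LinearMap.ker f.hom)
      (hL.of_injective _ (Submodule.injective_subtype _))
    rw [Subsingleton.elim η 0, Abelian.Ext.comp_zero]

end

section

variable {R : Type} [CommRing R]

/-- The group `extModule R n X M` vanishes iff every `n`-cocycle on a projective resolution of `X`
with values in `M` is a coboundary. -/
lemma subsingleton_extModule_iff {X : ModuleCat.{0} R} (P : ProjectiveResolution X)
    (M : ModuleCat.{0} R) (n : ℕ) :
    Subsingleton (extModule R n X M) ↔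
      ∀ f : P.complex.X n ⟶ M, P.complex.d (n + 1) n ≫ f = 0 →
        ∃ g : P.complex.X ((ComplexShape.up ℕ).prev n) ⟶ M,
          P.complex.d n ((ComplexShape.up ℕ).prev n) ≫ g = f := by
  rw [extModule, ← ModuleCat.isZero_iff_subsingleton, (P.isoExt n M).isZero_iff,
    ← HomologicalComplex.exactAt_iff_isZero_homology,
    HomologicalComplex.exactAt_iff' _ _ n (n + 1) rfl (by simp),
    ShortComplex.moduleCat_exact_iff]
  rfl

lemma subsingleton_ext_of_extModule {X M : ModuleCat.{0} R} {n : ℕ}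
    (h : Subsingleton (extModule R n X M)) : Subsingleton (Abelian.Ext X M n) := by
  let P := projectiveResolution X
  rw [subsingleton_extModule_iff P] at h
  refine subsingleton_of_forall_eq 0 fun ξ ↦ ?_
  obtain ⟨f, hf, rfl⟩ := P.extMk_surjective ξ (n + 1) rfl
  cases n with
  | zero =>
    obtain ⟨g, rfl⟩ := h f hf
    simp
  | succ n =>
    have hprev : (ComplexShape.up ℕ).prev (n + 1) = n := by simp
    rw [hprev] at h
    exact (P.extMk_eq_zero_iff _ _ _ hf n rfl).mpr (h f hf)

lemma subsingleton_extModule_succ_of_ext {X M : ModuleCat.{0} R} {n : ℕ}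
    (h : Subsingleton (Abelian.Ext X M (n + 1))) : Subsingleton (extModule R (n + 1) X M) := by
  let P := projectiveResolution X
  rw [subsingleton_extModule_iff P]
  intro f hf
  have hprev : (ComplexShape.up ℕ).prev (n + 1) = n := by simp
  rw [hprev]
  exact (P.extMk_eq_zero_iff f (n + 2) rfl hf n rfl).mp (Subsingleton.elim _ _)

end

/-- If `Ext^n_{R_p}(k(p), M_p) = 0` for some `n ≥ dim R_p`, then
`Ext^i_{R_p}(k(p), M_p) = 0` for all `i ≥ n`. -/
theorem ext_localized_rigidity
    (R : Type) [CommRing R] [IsNoetherianRing R] (p : Ideal R) [p.IsPrime]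
    (M : Type) [AddCommGroup M] [Module R M] (n : ℕ)
    (hn : ringKrullDim (Localization.AtPrime p) ≤ (n : WithBot (WithTop ℕ)))
    (hvan : Subsingleton (extModule (Localization.AtPrime p) n
      (ModuleCat.of (Localization.AtPrime p) (IsLocalRing.ResidueField (Localization.AtPrime p)))
      (ModuleCat.of (Localization.AtPrime p) (LocalizedModule p.primeCompl M)))) :
    ∀ i : ℕ, n ≤ i → Subsingleton (extModule (Localization.AtPrime p) i
      (ModuleCat.of (Localization.AtPrime p) (IsLocalRing.ResidueField (Localization.AtPrime p)))
      (ModuleCat.of (Localization.AtPrime p) (LocalizedModule p.primeCompl M))) := by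
  intro i hi
  obtain rfl | hlt := hi.eq_or_lt
  · exact hvan
  · obtain ⟨j, rfl⟩ := Nat.exists_eq_add_of_lt hlt
    have : IsNoetherianRing (Localization.AtPrime p) :=
      IsLocalization.isNoetherianRing p.primeCompl _ inferInstance
    exact subsingleton_extModule_succ_of_ext
      (subsingleton_ext_residueField_of_le _ n hn (subsingleton_ext_of_extModule hvan) _ hi)
end
end

section
/- Let R be a commutative noetherian ring of finite Krull dimension, p a prime ideal of R, and M an R-module. If Ext^n_R(k(p), M) = 0 for some integer n ≥ 2·dim R, then Ext^i_R(k(p), M) = 0 for all i ≥ n. -/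
open CategoryTheory Opposite

noncomputable section

/-- A module in which division by powers of ring elements is possible up to torsion,
without shrinking annihilators. -/
def PowDivisible (R : Type*) [CommRing R] (E : Type*) [AddCommGroup E] [Module R E] : Prop :=
  ∀ (x : R) (w : E) (a : ℕ), ∃ (w' : E) (m : ℕ),
    x ^ (m + a) • w' = x ^ m • w ∧ ∀ r : R, r • w = 0 → r • w' = 0

theorem PowDivisible.of_injective {R : Type*} [CommRing R] [IsNoetherianRing R] {E : Type*}
    [AddCommGroup E] [Module R E] (hE : Module.Baer R E) : PowDivisible R E := by
  intro x w a
  let N : Submodule R E := Submodule.span R {w}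
  have : IsNoetherian R N := isNoetherian_of_isNoetherianRing_of_finite R N
  let f : Module.End R N := LinearMap.lsmul R N x
  have hf : ∀ (k : ℕ) (n : N), (f ^ k) n = x ^ k • n := by
    intro k
    induction k with
    | zero => intro n; simp
    | succ k ih =>
      intro n
      rw [pow_succ, Module.End.mul_apply, ih, pow_succ, mul_smul]
      rfl
  obtain ⟨m, hm⟩ := Filter.eventually_atTop.mp f.eventually_disjoint_ker_pow_range_pow
  let w₀ : N := ⟨w, Submodule.mem_span_singleton_self w⟩
  let m' := max m a
  have hd : Disjoint (LinearMap.ker (f ^ m')) (LinearMap.range (f ^ m')) := hm m' (le_max_left _ _)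
  have hinj : ∀ n : LinearMap.range (f ^ m'), (f ^ a) (n : N) = 0 → n = 0 := by
    rintro ⟨n, hn⟩ h0
    have hk : n ∈ LinearMap.ker (f ^ m') := by
      have hm' : m' = m' - a + a := (Nat.sub_add_cancel (le_max_right m a)).symm
      rw [LinearMap.mem_ker, hf, hm', pow_add, mul_smul]
      have : x ^ a • n = 0 := by rw [← hf]; exact h0
      rw [this, smul_zero]
    have := (Submodule.disjoint_def.mp hd) n hk hn
    exact Subtype.ext this
  let i : LinearMap.range (f ^ m') →ₗ[R] N := (f ^ a) ∘ₗ (LinearMap.range (f ^ m')).subtype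
  have hi : Function.Injective i := by
    rw [← LinearMap.ker_eq_bot, LinearMap.ker_eq_bot']
    exact fun n hn ↦ hinj n hn
  obtain ⟨h, hh⟩ := Module.Baer.extension_property hE i hi
    (N.subtype ∘ₗ (LinearMap.range (f ^ m')).subtype)
  refine ⟨h w₀, m', ?_, ?_⟩
  · have := LinearMap.congr_fun hh ⟨(f ^ m') w₀, w₀, rfl⟩
    simp only [i, LinearMap.comp_apply, Submodule.subtype_apply] at this
    rw [hf, hf, smul_smul, ← pow_add, map_smul] at this
    rw [add_comm, this]
    rfl
  · intro r hr
    rw [← map_smul]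
    have : r • w₀ = 0 := Subtype.ext hr
    rw [this, map_zero]

theorem exists_primary_sum_of_injective {R : Type*} [CommRing R] [IsNoetherianRing R] {E : Type*}
    [AddCommGroup E] [Module R E] (hE : Module.Baer R E) (e : E) :
    ∃ (s : Finset (Ideal R)) (g : Ideal R → E), (∀ Q ∈ s, Ideal.IsPrimary Q) ∧
      (∀ Q ∈ s, ∀ r : R, r • e = 0 → r ∈ Q) ∧ (∀ Q ∈ s, ∀ r ∈ Q, r • g Q = 0) ∧
      e = ∑ Q ∈ s, g Q := by
  classical
  let I : Ideal R := LinearMap.ker (LinearMap.toSpanSingleton R E e)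
  obtain ⟨s, hs, hs'⟩ := Submodule.isLasker R R I
  have hle : ∀ Q ∈ s, I ≤ Q := fun Q hQ ↦ hs ▸ Finset.inf_le hQ
  let i : (R ⧸ I) →ₗ[R] (∀ Q : s, R ⧸ (Q : Ideal R)) :=
    LinearMap.pi fun Q ↦ Submodule.mapQ I (Q : Ideal R) LinearMap.id (hle Q Q.2)
  have hi : Function.Injective i := by
    rw [← LinearMap.ker_eq_bot, LinearMap.ker_eq_bot']
    intro n hn
    obtain ⟨n, rfl⟩ := Submodule.Quotient.mk_surjective _ n
    rw [Submodule.Quotient.mk_eq_zero, ← hs]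
    simp only [Submodule.mem_finsetInf, id]
    intro Q hQ
    have := congr_fun hn ⟨Q, hQ⟩
    exact (Submodule.Quotient.mk_eq_zero _).mp this
  obtain ⟨h, hh⟩ := Module.Baer.extension_property hE i hi
    (I.liftQ (LinearMap.toSpanSingleton R E e) le_rfl)
  refine ⟨s, fun Q ↦ if hQ : Q ∈ s then
    h (Pi.single (⟨Q, hQ⟩ : s) (Submodule.Quotient.mk 1)) else 0, hs', ?_, ?_, ?_⟩
  · intro Q hQ r hr
    exact hle Q hQ hr
  · intro Q hQ r hr
    beta_reduce
    rw [dif_pos hQ, ← map_smul, ← Pi.single_smul]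
    have : r • (Submodule.Quotient.mk 1 : R ⧸ Q) = 0 := by
      rw [← Submodule.Quotient.mk_smul, Submodule.Quotient.mk_eq_zero]
      simpa using hr
    rw [this, Pi.single_zero, map_zero]
  · have h1 := LinearMap.congr_fun hh (Submodule.Quotient.mk 1)
    simp only [LinearMap.comp_apply, Submodule.liftQ_apply, LinearMap.toSpanSingleton_apply,
      one_smul] at h1
    rw [← h1]
    have h2 : i (Submodule.Quotient.mk 1) =
        ∑ Q : s, Pi.single Q (Submodule.Quotient.mk 1 : R ⧸ (Q : Ideal R)) := by
      ext Q
      rw [Finset.sum_apply, Finset.sum_pi_single]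
      simp [i]
    rw [h2, map_sum, ← Finset.sum_coe_sort s]
    refine Finset.sum_congr rfl fun Q _ ↦ ?_
    rw [dif_pos Q.2]

/-- In a complex of power divisible modules which is exact in degrees `> c`, torsion cycles of
large degree are boundaries of torsion elements. -/
theorem exists_torsion_preimage_s2 {S : Type*} [CommRing S] {J : ℕ → Type*}
    [∀ i, AddCommGroup (J i)] [∀ i, Module S (J i)] (δ : ∀ i, J i →ₗ[S] J (i + 1))
    (hδ : ∀ i y, δ (i + 1) (δ i y) = 0) (hJ : ∀ i, PowDivisible S (J i)) (c : ℕ)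
    (hex : ∀ i, c ≤ i → ∀ z : J (i + 1), δ (i + 1) z = 0 → ∃ y, δ i y = z) (l : List S) :
    ∀ i, c + l.length ≤ i → ∀ z : J (i + 1), δ (i + 1) z = 0 →
      (∀ x ∈ l, ∃ a : ℕ, x ^ a • z = 0) → ∃ y, δ i y = z ∧ ∀ x ∈ l, ∃ a : ℕ, x ^ a • y = 0 := by
  induction l with
  | nil =>
    intro i hi z hz _
    obtain ⟨y, hy⟩ := hex i (by simpa using hi) z hz
    exact ⟨y, hy, by simp⟩
  | cons x l ih =>
    intro i hi z hz ht
    rw [List.length_cons] at hi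
    obtain ⟨i, rfl⟩ : ∃ j, i = j + 1 := ⟨i - 1, by omega⟩
    obtain ⟨y, hy, hyt⟩ := ih (i + 1) (by omega) z hz
      fun x' hx' ↦ ht x' (List.mem_cons_of_mem _ hx')
    obtain ⟨a, ha⟩ := ht x List.mem_cons_self
    obtain ⟨w, hw, hwt⟩ := ih i (by omega) (x ^ a • y) (by rw [map_smul, hy, ha])
      fun x' hx' ↦ by
        obtain ⟨b, hb⟩ := hyt x' hx'
        exact ⟨b, by rw [smul_comm, hb, smul_zero]⟩
    obtain ⟨w', m, hm, hann⟩ := hJ i x w a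
    refine ⟨y - δ i w', by rw [map_sub, hδ, sub_zero, hy], ?_⟩
    intro x' hx'
    rcases List.mem_cons.mp hx' with rfl | hx'
    · refine ⟨m + a, ?_⟩
      rw [smul_sub, ← map_smul, hm, map_smul, hw, smul_smul, pow_add, sub_self]
    · obtain ⟨b, hb⟩ := hyt x' hx'
      obtain ⟨b', hb'⟩ := hwt x' hx'
      refine ⟨b + b', ?_⟩
      rw [smul_sub, ← map_smul, hann _ (by rw [pow_add, mul_smul, hb', smul_zero]), map_zero,
        pow_add, mul_comm, mul_smul, hb, smul_zero, sub_zero]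

section Devissage

variable {S : Type*} [CommRing S] (m : Ideal S) [m.IsMaximal] {A B C : Type*}
  [AddCommGroup A] [Module S A] [AddCommGroup B] [Module S B] [AddCommGroup C] [Module S C]
  (f : A →ₗ[S] B) (g : B →ₗ[S] C)

theorem exists_lift_of_smul_eq_zero
    (h : ∀ y, (∀ r ∈ m, r • y = 0) → g y = 0 → ∃ x, f x = y ∧ ∀ r ∈ m, r • x = 0)
    {K : Type*} [AddCommGroup K] [Module S K] (hK : ∀ r ∈ m, ∀ v : K, r • v = 0)
    (φ : K →ₗ[S] B) (hφ : ∀ v, g (φ v) = 0) : ∃ ψ : K →ₗ[S] A, ∀ v, f (ψ v) = φ v := by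
  let _ : Field (S ⧸ m) := Ideal.Quotient.field m
  have htor : Module.IsTorsionBySet S K m := fun v r ↦ hK r r.2 v
  let _ : Module (S ⧸ m) K := htor.module
  let b := Module.Free.chooseBasis (S ⧸ m) K
  have hx : ∀ i, ∃ x : A, f x = φ (b i) ∧ ∀ r ∈ m, r • x = 0 := fun i ↦
    h _ (fun r hr ↦ by rw [← map_smul, hK r hr, map_zero]) (hφ _)
  choose x hx hxm using hx
  let A' := Submodule.torsionBySet S A m
  let x' : _ → A' := fun i ↦ ⟨x i, (Submodule.mem_torsionBySet_iff _ _).mpr fun r ↦ hxm i r r.2⟩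
  let ψ : K →ₗ[S ⧸ m] A' := b.constr (S ⧸ m) x'
  have hψ : ∀ (s : S) (v : K), ψ (s • v) = s • ψ v := fun s v ↦
    ψ.map_smul (Ideal.Quotient.mk m s) v
  refine ⟨{ toFun := fun v ↦ (ψ v : A), map_add' := fun v w ↦ by simp,
            map_smul' := fun s v ↦ by rw [hψ]; rfl }, fun v ↦ ?_⟩
  change f (ψ v : A) = φ v
  have hv : v ∈ Submodule.span (S ⧸ m) (Set.range b) := by rw [b.span_eq]; trivial
  induction hv using Submodule.span_induction with
  | mem v hv =>
    obtain ⟨i, rfl⟩ := hv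
    rw [b.constr_basis, ← hx i]
  | zero => simp
  | add v w _ _ hv hw => rw [map_add, map_add, Submodule.coe_add, map_add, hv, hw]
  | smul c v _ hv =>
    obtain ⟨s, rfl⟩ := Ideal.Quotient.mk_surjective c
    change f (ψ (s • v) : A) = φ (s • v)
    rw [hψ, Submodule.coe_smul, map_smul, hv, map_smul]

theorem exists_lift_of_pow_smul_eq_zero (hA : Module.Baer S A) (hgf : ∀ x, g (f x) = 0)
    (h : ∀ y, (∀ r ∈ m, r • y = 0) → g y = 0 → ∃ x, f x = y ∧ ∀ r ∈ m, r • x = 0) (t : ℕ) :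
    ∀ {K : Type*} [AddCommGroup K] [Module S K] (_ : ∀ r ∈ m ^ t, ∀ v : K, r • v = 0)
    (φ : K →ₗ[S] B) (_ : ∀ v, g (φ v) = 0), ∃ ψ : K →ₗ[S] A, ∀ v, f (ψ v) = φ v := by
  induction t with
  | zero =>
    intro K _ _ hK φ _
    have hK' : ∀ v : K, v = 0 := fun v ↦ by simpa using hK 1 (by simp) v
    exact ⟨0, fun v ↦ by rw [hK' v, map_zero, map_zero, map_zero]⟩
  | succ t ih =>
    intro K _ _ hK φ hφ
    let N : Submodule S K := m • ⊤
    have hN : ∀ r ∈ m ^ t, ∀ v : N, r • v = 0 := by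
      rintro r hr ⟨v, hv⟩
      apply Subtype.ext
      change r • v = 0
      refine Submodule.smul_induction_on hv (fun s hs w _ ↦ ?_) fun v w hv hw ↦ ?_
      · rw [smul_smul]
        exact hK _ (by rw [pow_succ]; exact Ideal.mul_mem_mul hr hs) w
      · rw [smul_add, hv, hw, add_zero]
    obtain ⟨ψ₁, hψ₁⟩ := ih hN (φ ∘ₗ N.subtype) fun v ↦ hφ v
    obtain ⟨ψ₂, hψ₂⟩ := Module.Baer.extension_property hA N.subtype N.subtype_injective ψ₁
    have hker : N ≤ LinearMap.ker (φ - f ∘ₗ ψ₂) := by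
      intro v hv
      have h1 := hψ₁ ⟨v, hv⟩
      have h2 := LinearMap.congr_fun hψ₂ ⟨v, hv⟩
      simp only [LinearMap.comp_apply, Submodule.subtype_apply] at h1 h2
      rw [LinearMap.mem_ker, LinearMap.sub_apply, LinearMap.comp_apply, h2, h1, sub_self]
    obtain ⟨ψ₃, hψ₃⟩ := exists_lift_of_smul_eq_zero m f g h (K := K ⧸ N)
      (by
        intro r hr v
        obtain ⟨v, rfl⟩ := Submodule.Quotient.mk_surjective _ v
        rw [← Submodule.Quotient.mk_smul, Submodule.Quotient.mk_eq_zero]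
        exact Submodule.smul_mem_smul hr trivial)
      (N.liftQ (φ - f ∘ₗ ψ₂) hker)
      (by
        intro v
        obtain ⟨v, rfl⟩ := Submodule.Quotient.mk_surjective _ v
        simp [hφ, hgf])
    refine ⟨ψ₂ + ψ₃ ∘ₗ N.mkQ, fun v ↦ ?_⟩
    rw [LinearMap.add_apply, map_add, LinearMap.comp_apply, hψ₃]
    simp

theorem exists_smul_eq_zero_preimage (hA : Module.Baer S A) (hgf : ∀ x, g (f x) = 0)
    (h : ∀ y, (∀ r ∈ m, r • y = 0) → g y = 0 → ∃ x, f x = y ∧ ∀ r ∈ m, r • x = 0)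
    (y : B) (t : ℕ) (hy : ∀ r ∈ m ^ t, r • y = 0) (hz : ∀ r ∈ m, r • g y = 0) :
    ∃ y', g y' = g y ∧ ∀ r ∈ m, r • y' = 0 := by
  let K : Submodule S B := m • Submodule.span S {y}
  have hKy : ∀ v ∈ K, ∃ r ∈ m, v = r • y := fun v hv ↦ by
    obtain ⟨r, hr, rfl⟩ := Submodule.mem_smul_span_singleton.mp hv
    exact ⟨r, hr, rfl⟩
  obtain ⟨ψ, hψ⟩ := exists_lift_of_pow_smul_eq_zero m f g hA hgf h t (K := K)
    (by
      rintro r hr ⟨v, hv⟩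
      obtain ⟨s, hs, rfl⟩ := hKy v hv
      apply Subtype.ext
      change r • s • y = 0
      rw [smul_comm, hy r hr, smul_zero])
    K.subtype
    (by
      rintro ⟨v, hv⟩
      obtain ⟨s, hs, rfl⟩ := hKy v hv
      change g (s • y) = 0
      rw [map_smul, hz s hs])
  obtain ⟨ψ', hψ'⟩ := Module.Baer.extension_property hA K.subtype K.subtype_injective ψ
  refine ⟨y - f (ψ' y), by rw [map_sub, hgf, sub_zero], fun r hr ↦ ?_⟩
  have hmem : r • y ∈ K := Submodule.smul_mem_smul hr (Submodule.mem_span_singleton_self y)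
  have h1 := hψ ⟨r • y, hmem⟩
  have h2 := LinearMap.congr_fun hψ' ⟨r • y, hmem⟩
  simp only [LinearMap.comp_apply, Submodule.subtype_apply] at h1 h2
  rw [smul_sub, ← map_smul, ← map_smul, h2, h1, sub_self]

end Devissage

/-- Exactness, at the given degree, of the subcomplex of elements annihilated by `m`. -/
def SocleExact {S : Type*} [CommRing S] (m : Ideal S) {J : ℕ → Type*}
    [∀ i, AddCommGroup (J i)] [∀ i, Module S (J i)] (δ : ∀ i, J i →ₗ[S] J (i + 1)) : ℕ → Prop
  | 0 => ∀ y : J 0, (∀ r ∈ m, r • y = 0) → δ 0 y = 0 → y = 0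
  | n + 1 => ∀ y : J (n + 1), (∀ r ∈ m, r • y = 0) → δ (n + 1) y = 0 →
      ∃ x, δ n x = y ∧ ∀ r ∈ m, r • x = 0

theorem SocleExact.of_le {S : Type*} [CommRing S] [IsNoetherianRing S] (m : Ideal S) [m.IsMaximal]
    {J : ℕ → Type*} [∀ i, AddCommGroup (J i)] [∀ i, Module S (J i)]
    (δ : ∀ i, J i →ₗ[S] J (i + 1)) (hδ : ∀ i y, δ (i + 1) (δ i y) = 0)
    (hJ : ∀ i, Module.Baer S (J i)) (c : ℕ)
    (hex : ∀ i, c ≤ i → ∀ z : J (i + 1), δ (i + 1) z = 0 → ∃ y, δ i y = z) (l : List S)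
    (hl : m ≤ (Ideal.span {x | x ∈ l}).radical) (hlm : ∀ x ∈ l, x ∈ m)
    {n : ℕ} (hn : c + l.length ≤ n)
    (h : SocleExact m δ n) {i : ℕ} (hi : n ≤ i) : SocleExact m δ i := by
  have hJ' : ∀ i, PowDivisible S (J i) := fun i ↦ .of_injective (hJ i)
  induction i, hi using Nat.le_induction with
  | base => exact h
  | succ i hi ih =>
    intro z hz hδz
    have key : ∃ y : J i, δ i y = z ∧ ∃ t, ∀ r ∈ m ^ t, r • y = 0 := by
      obtain ⟨y, hy, hyt⟩ := exists_torsion_preimage_s2 δ hδ hJ' c hex l i (by omega) z hδz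
        fun x hx ↦ ⟨1, by rw [pow_one, hz x (hlm x hx)]⟩
      let I : Ideal S := LinearMap.ker (LinearMap.toSpanSingleton S (J i) y)
      have hI : m ≤ I.radical := hl.trans <| by
        rw [Ideal.radical_le_radical_iff, Ideal.span_le]
        exact hyt
      obtain ⟨t, ht⟩ := Ideal.exists_pow_le_of_le_radical_of_fg hI (IsNoetherian.noetherian m)
      exact ⟨y, hy, t, fun r hr ↦ ht hr⟩
    obtain ⟨y, rfl, t, ht⟩ := key
    cases i with
    | zero =>
      exact exists_smul_eq_zero_preimage m (0 : PUnit →ₗ[S] J 0) (δ 0)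
        (fun _ _ ↦ ⟨0, fun _ _ ↦ rfl⟩) (by simp) (fun y hy hy' ↦ ⟨0, by simp [ih y hy hy'], by simp⟩)
        y t ht hz
    | succ i => exact exists_smul_eq_zero_preimage m (δ i) (δ (i + 1)) (hJ _) (hδ _) ih y t ht hz

/-- The coextension of scalars `Hom_R(S, N)`, as an `S`-module. -/
def Coext (R S N : Type*) [CommRing R] [CommRing S] [Algebra R S] [AddCommGroup N] [Module R N] :=
  S →ₗ[R] N

namespace Coext

variable {R S N : Type*} [CommRing R] [CommRing S] [Algebra R S] [AddCommGroup N] [Module R N]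

instance : AddCommGroup (Coext R S N) := inferInstanceAs (AddCommGroup (S →ₗ[R] N))

instance : Module S (Coext R S N) where
  smul s h := LinearMap.comp (M₂ := S) h (LinearMap.mulRight R s)
  one_smul h := LinearMap.ext fun t ↦ congrArg (DFunLike.coe (F := S →ₗ[R] N) h) (mul_one t)
  mul_smul s s' h := LinearMap.ext fun t ↦
    congrArg (DFunLike.coe (F := S →ₗ[R] N) h) (by simp [mul_assoc])
  smul_zero _ := rfl
  smul_add _ _ _ := rfl
  add_smul s s' h := LinearMap.ext fun t ↦
    (congrArg (DFunLike.coe (F := S →ₗ[R] N) h) (by simp [mul_add])).trans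
      (LinearMap.map_add (M := S) h (t * s) (t * s'))
  zero_smul h := LinearMap.ext fun t ↦
    (congrArg (DFunLike.coe (F := S →ₗ[R] N) h) (by simp)).trans (LinearMap.map_zero (M := S) h)

/-- The underlying `R`-linear map. -/
def toLin (h : Coext R S N) : S →ₗ[R] N := h

@[simp] lemma toLin_smul (s : S) (h : Coext R S N) (t : S) :
    (s • h).toLin t = h.toLin (t * s) := rfl

@[simp] lemma toLin_zero : (0 : Coext R S N).toLin = 0 := rfl

@[simp] lemma toLin_add (h h' : Coext R S N) : (h + h').toLin = h.toLin + h'.toLin := rfl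

@[ext] lemma ext {h h' : Coext R S N} (H : ∀ t, h.toLin t = h'.toLin t) : h = h' :=
  LinearMap.ext H

/-- Functoriality of coextension. -/
def map {N' : Type*} [AddCommGroup N'] [Module R N'] (f : N →ₗ[R] N') :
    Coext R S N →ₗ[S] Coext R S N' where
  toFun h := f ∘ₗ h.toLin
  map_add' _ _ := LinearMap.comp_add _ _ _
  map_smul' _ _ := rfl

@[simp] lemma toLin_map {N' : Type*} [AddCommGroup N'] [Module R N'] (f : N →ₗ[R] N')
    (h : Coext R S N) (t : S) : (map f h).toLin t = f (h.toLin t) := rfl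

theorem baer (hN : Module.Baer R N) : Module.Baer S (Coext R S N) := by
  intro I g
  let g₁ : I.restrictScalars R →ₗ[R] N :=
    { toFun := fun i ↦ (g i).toLin 1
      map_add' := fun i j ↦ by
        have := g.map_add i j
        exact congrArg (fun h ↦ h.toLin 1) this
      map_smul' := fun r i ↦ by
        refine (congrArg (fun h ↦ h.toLin 1) ((congrArg g (Subtype.ext
          (algebra_compatible_smul S r (i : S)))).trans
            (g.map_smul (algebraMap R S r) i))).trans ?_
        rw [toLin_smul, one_mul, RingHom.id_apply, Algebra.algebraMap_eq_smul_one, map_smul] }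
  obtain ⟨h, hh⟩ := Module.Baer.extension_property hN (I.restrictScalars R).subtype
    (Submodule.subtype_injective _) g₁
  refine ⟨LinearMap.toSpanSingleton S _ (show Coext R S N from h), fun x hx ↦ ?_⟩
  ext t
  have h1 := LinearMap.congr_fun hh ⟨t * x, I.mul_mem_left t hx⟩
  have h2 := g.map_smul t ⟨x, hx⟩
  change h (t * x) = _
  refine h1.trans ?_
  change (g ⟨t * x, _⟩).toLin 1 = _
  have h3 : (⟨t * x, I.mul_mem_left t hx⟩ : I) = t • ⟨x, hx⟩ := rfl
  rw [h3, h2, toLin_smul, one_mul]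

end Coext

section ExtComparison

variable {R : Type} [CommRing R] (X M : ModuleCat.{0} R)

theorem subsingleton_extModule_iff_s2 (n : ℕ) :
    Subsingleton (extModule R n X M) ↔ Subsingleton (Abelian.Ext X M n) := by
  let P := projectiveResolution X
  have e := (P.isoExt (R := R) n M).toLinearEquiv
  have h1 : Subsingleton (extModule R n X M) ↔
      (P.complex.linearYonedaObj R M).ExactAt n := by
    rw [HomologicalComplex.exactAt_iff_isZero_homology, ModuleCat.isZero_iff_subsingleton]
    exact e.toEquiv.subsingleton_congr
  rw [h1]
  cases n with
  | zero =>
    rw [HomologicalComplex.exactAt_iff' _ 0 0 1 (by simp) (by simp),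
      ShortComplex.moduleCat_exact_iff, Abelian.Ext.homEquiv₀.subsingleton_congr]
    constructor
    · intro h
      refine subsingleton_of_forall_eq 0 fun α ↦ ?_
      let e₀ := HomologicalComplex.singleObjXSelf (ComplexShape.down ℕ) 0 X
      obtain ⟨g, hg⟩ := h (P.π.f 0 ≫ e₀.hom ≫ α) (by
        change P.complex.d 1 0 ≫ P.π.f 0 ≫ _ = 0
        rw [← Category.assoc, P.complex_d_comp_π_f_zero, Limits.zero_comp])
      have hg' : P.complex.d 0 0 ≫ g = P.π.f 0 ≫ e₀.hom ≫ α := hg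
      have h0 : P.complex.d 0 0 ≫ (show P.complex.X 0 ⟶ M from g) = 0 := by
        rw [P.complex.shape 0 0 (by simp), Limits.zero_comp]
      have := (cancel_epi (P.π.f 0)).mp ((hg'.symm.trans h0).trans Limits.comp_zero.symm)
      exact (cancel_epi e₀.hom).mp (this.trans Limits.comp_zero.symm)
    · intro h (f : P.complex.X 0 ⟶ M) (hf : P.complex.d 1 0 ≫ f = 0)
      let e₀ := HomologicalComplex.singleObjXSelf (ComplexShape.down ℕ) 0 X
      obtain ⟨g, hg⟩ := Limits.CokernelCofork.IsColimit.desc' P.isColimitCokernelCofork f hf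
      have hg0 : e₀.inv ≫ g = 0 := Subsingleton.elim _ _
      have hg1 : g = 0 := (cancel_epi e₀.inv).mp (hg0.trans Limits.comp_zero.symm)
      refine ⟨(0 : P.complex.X 0 ⟶ M), ?_⟩
      rw [← hg, hg1, Limits.comp_zero]
      exact Limits.comp_zero (f := P.complex.d 0 0)
  | succ n =>
    rw [HomologicalComplex.exactAt_iff' _ n (n + 1) (n + 2) (by simp) (by simp),
      ShortComplex.moduleCat_exact_iff]
    constructor
    · intro h
      refine subsingleton_of_forall_eq 0 fun α ↦ ?_
      obtain ⟨f, hf, rfl⟩ := P.extMk_surjective α (n + 2) rfl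
      rw [P.extMk_eq_zero_iff f _ _ hf n rfl]
      obtain ⟨g, hg⟩ := h f hf
      exact ⟨g, hg⟩
    · intro h f hf
      have := (P.extMk_eq_zero_iff f (n + 2) rfl hf n rfl).mp (Subsingleton.elim _ _)
      exact this

end ExtComparison

section LocalRigidity

variable {R : Type} [CommRing R] {M : ModuleCat.{0} R} (I : InjectiveResolution M)

/-- The differential of the coextension of scalars of an injective resolution. -/
def coextD (S : Type) [CommRing S] [Algebra R S] (i : ℕ) :
    Coext R S (I.cocomplex.X i) →ₗ[S] Coext R S (I.cocomplex.X (i + 1)) :=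
  Coext.map (I.cocomplex.d i (i + 1)).hom

variable {S : Type} [CommRing S] [Algebra R S]

theorem coextD_comp (i : ℕ) (y : Coext R S (I.cocomplex.X i)) :
    coextD I S (i + 1) (coextD I S i y) = 0 := by
  ext t
  exact ConcreteCategory.congr_hom (I.cocomplex.d_comp_d i (i + 1) (i + 2)) (y.toLin t)

theorem baer_of_injective_object {N : ModuleCat.{0} R} [CategoryTheory.Injective N] :
    Module.Baer R N := by
  have : CategoryTheory.Injective (ModuleCat.of R N) := ‹_›
  exact .of_injective (Module.injective_module_of_injective_object R N)

theorem coextD_exact {c : ℕ}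
    (h : ∀ i, c < i → Subsingleton (Abelian.Ext (ModuleCat.of R S) M i)) (i : ℕ) (hi : c ≤ i)
    (z : Coext R S (I.cocomplex.X (i + 1))) (hz : coextD I S (i + 1) z = 0) :
    ∃ y, coextD I S i y = z := by
  have := h (i + 1) (by omega)
  let f : ModuleCat.of R S ⟶ I.cocomplex.X (i + 1) := ModuleCat.ofHom z.toLin
  have hf : f ≫ I.cocomplex.d (i + 1) (i + 2) = 0 := by
    ext t
    exact LinearMap.congr_fun (congrArg Coext.toLin hz) t
  obtain ⟨g, hg⟩ := (I.extMk_eq_zero_iff f (i + 2) rfl hf i rfl).mp (Subsingleton.elim _ _)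
  refine ⟨show Coext R S _ from g.hom, ?_⟩
  ext t
  exact ConcreteCategory.congr_hom hg t

variable {k : Type} [AddCommGroup k] [Module R k] (m : Ideal S) (π : S →ₗ[R] k)
  (hπ : Function.Surjective π) (hm : ∀ s, π s = 0 ↔ s ∈ m)

include hπ hm in
theorem exists_factor_of_smul_eq_zero {N : Type} [AddCommGroup N] [Module R N]
    (y : Coext R S N) (hy : ∀ r ∈ m, r • y = 0) : ∃ f : k →ₗ[R] N, ∀ s, f (π s) = y.toLin s := by
  have hle : LinearMap.ker π ≤ LinearMap.ker y.toLin := by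
    intro s hs
    have := congrArg (fun h ↦ h.toLin 1) (hy s ((hm s).mp hs))
    simpa using this
  refine ⟨(LinearMap.ker π).liftQ y.toLin hle ∘ₗ
    (π.quotKerEquivOfSurjective hπ).symm.toLinearMap, fun s ↦ ?_⟩
  have : (π.quotKerEquivOfSurjective hπ).symm (π s) = Submodule.Quotient.mk s := by
    rw [LinearEquiv.symm_apply_eq]
    rfl
  simp [this]

include hm in
theorem smul_comp_eq_zero {N : Type} [AddCommGroup N] [Module R N] (f : k →ₗ[R] N) :
    ∀ r ∈ m, r • (show Coext R S N from f ∘ₗ π) = 0 := by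
  intro r hr
  ext t
  change f (π (t * r)) = 0
  rw [(hm _).mpr (m.mul_mem_left t hr), map_zero]

include hπ hm in
theorem socleExact_of_subsingleton_ext (n : ℕ)
    (h : Subsingleton (Abelian.Ext (ModuleCat.of R k) M n)) : SocleExact m (coextD I S) n := by
  cases n with
  | zero =>
    intro y hy hδ
    obtain ⟨f, hf⟩ := exists_factor_of_smul_eq_zero m π hπ hm y hy
    have hd : ModuleCat.ofHom f ≫ I.cocomplex.d 0 1 = 0 := by
      ext t
      obtain ⟨s, rfl⟩ := hπ t
      exact (congrArg (I.cocomplex.d 0 1).hom (hf s)).trans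
        (LinearMap.congr_fun (congrArg Coext.toLin hδ) s)
    obtain ⟨g, hg⟩ := Limits.KernelFork.IsLimit.lift' I.isLimitKernelFork _ hd
    have hs := Abelian.Ext.homEquiv₀.subsingleton_congr.mp h
    let e₀ := HomologicalComplex.singleObjXSelf (ComplexShape.up ℕ) 0 M
    have hg0 : g ≫ e₀.hom = 0 := hs.elim _ _
    have hg1 : g = 0 := (cancel_mono e₀.hom).mp (hg0.trans Limits.zero_comp.symm)
    rw [hg1, Limits.zero_comp] at hg
    ext t
    rw [← hf]
    exact (ConcreteCategory.congr_hom hg (π t)).symm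
  | succ n =>
    intro y hy hδ
    obtain ⟨f, hf⟩ := exists_factor_of_smul_eq_zero m π hπ hm y hy
    have hd : ModuleCat.ofHom f ≫ I.cocomplex.d (n + 1) (n + 2) = 0 := by
      ext t
      obtain ⟨s, rfl⟩ := hπ t
      exact (congrArg (I.cocomplex.d (n + 1) (n + 2)).hom (hf s)).trans
        (LinearMap.congr_fun (congrArg Coext.toLin hδ) s)
    obtain ⟨g, hg⟩ := (I.extMk_eq_zero_iff _ (n + 2) rfl hd n rfl).mp (Subsingleton.elim _ _)
    refine ⟨show Coext R S _ from g.hom ∘ₗ π, ?_, smul_comp_eq_zero m π hm g.hom⟩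
    ext t
    exact (ConcreteCategory.congr_hom hg (π t)).trans (hf t)

include hπ hm in
theorem subsingleton_ext_of_socleExact (n : ℕ) (h : SocleExact m (coextD I S) (n + 1)) :
    Subsingleton (Abelian.Ext (ModuleCat.of R k) M (n + 1)) := by
  refine subsingleton_of_forall_eq 0 fun α ↦ ?_
  obtain ⟨f, hf, rfl⟩ := I.extMk_surjective α (n + 2) rfl
  rw [I.extMk_eq_zero_iff f _ _ hf n rfl]
  obtain ⟨x, hx, hxm⟩ := h (show Coext R S _ from f.hom ∘ₗ π) (smul_comp_eq_zero m π hm f.hom) (by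
    ext t
    exact ConcreteCategory.congr_hom hf (π t))
  obtain ⟨g, hg⟩ := exists_factor_of_smul_eq_zero m π hπ hm x hxm
  refine ⟨ModuleCat.ofHom g, ?_⟩
  ext t
  obtain ⟨s, rfl⟩ := hπ t
  exact (congrArg (I.cocomplex.d n (n + 1)).hom (hg s)).trans
    (LinearMap.congr_fun (congrArg Coext.toLin hx) s)

end LocalRigidity

theorem ext_residueField_rigidity_of_localization {R : Type} [CommRing R] [IsNoetherianRing R]
    (p : Ideal R) [p.IsPrime] (M : ModuleCat.{0} R) (d : ℕ) (hdim : ringKrullDim R = d)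
    (hA : ∀ i, d < i → Subsingleton
      (Abelian.Ext (ModuleCat.of R (Localization.AtPrime p)) M i)) {n : ℕ} (hn : 2 * d ≤ n)
    (hvan : Subsingleton (Abelian.Ext (ModuleCat.of R (resField R p)) M n)) {i : ℕ} (hi : n ≤ i) :
    Subsingleton (Abelian.Ext (ModuleCat.of R (resField R p)) M i) := by
  rcases hi.eq_or_lt with rfl | hlt
  · exact hvan
  obtain ⟨i, rfl⟩ : ∃ j, i = j + 1 := ⟨i - 1, by omega⟩
  let S := Localization.AtPrime p
  have : IsNoetherianRing S := IsLocalization.isNoetherianRing p.primeCompl S inferInstance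
  let m := IsLocalRing.maximalIdeal S
  let I := injectiveResolution M
  let π : S →ₗ[R] resField R p := (IsScalarTower.toAlgHom R S (resField R p)).toLinearMap
  have hπ : Function.Surjective π := IsLocalRing.residue_surjective
  have hm : ∀ s, π s = 0 ↔ s ∈ m := fun s ↦ IsLocalRing.residue_eq_zero_iff s
  have hht : m.height ≤ d := by
    have h1 : (m.height : WithBot ℕ∞) = p.height := by
      rw [IsLocalRing.maximalIdeal_height_eq_ringKrullDim,
        IsLocalization.AtPrime.ringKrullDim_eq_height p S]
    have h2 : (p.height : WithBot ℕ∞) ≤ ringKrullDim R :=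
      Ideal.height_le_ringKrullDim_of_ne_top Ideal.IsPrime.ne_top'
    rw [← h1, hdim] at h2
    exact WithBot.coe_le_coe.mp h2
  obtain ⟨s, hs, hcard⟩ := m.exists_finset_card_eq_height_of_isNoetherianRing
  have hlen : s.card ≤ d := by
    rw [← hcard] at hht
    exact_mod_cast hht
  refine subsingleton_ext_of_socleExact I m π hπ hm i ?_
  refine SocleExact.of_le m (coextD I S) (coextD_comp I)
    (fun j ↦ Coext.baer baer_of_injective_object) d (coextD_exact I hA) s.toList ?_ ?_ (n := n)
    ?_ (socleExact_of_subsingleton_ext I m π hπ hm n hvan) hi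
  · have hset : {x | x ∈ s.toList} = (s : Set S) := by ext; simp
    rw [hset, Ideal.radical_eq_sInf]
    refine le_sInf fun q ⟨hq, hq'⟩ ↦ ?_
    exact hs.2 ⟨hq', hq⟩ (IsLocalRing.le_maximalIdeal hq'.ne_top)
  · intro x hx
    exact hs.1.2 (Ideal.subset_span (by simpa using hx))
  · rw [Finset.length_toList]; omega

namespace DerivedCategory

open CategoryTheory.Pretriangulated CochainComplex.HomComplex

universe w v u

variable {C : Type u} [Category.{v} C] [Abelian C] [HasDerivedCategory.{w} C]

/-- Vanishing of the morphisms of degree `> n` from `K` to `J` in the derived category. -/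
def ExtVanish (J K : CochainComplex C ℤ) (n : ℤ) : Prop :=
  ∀ i, n < i → ∀ f : Q.obj K ⟶ (Q.obj J)⟦i⟧, f = 0

theorem eq_zero_of_shift {X Y : DerivedCategory C} {i j : ℤ} (hij : i + 1 = j)
    (h : ∀ f : X ⟶ Y⟦i⟧, f = 0) (g : X⟦(1 : ℤ)⟧ ⟶ Y⟦j⟧) : g = 0 := by
  let e := (shiftFunctorAdd' (DerivedCategory C) i 1 j hij).app Y
  have h1 := h ((shiftFunctor _ (1 : ℤ)).preimage (g ≫ e.hom))
  have h2 := congrArg (shiftFunctor _ (1 : ℤ)).map h1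
  rw [Functor.map_preimage, Functor.map_zero] at h2
  exact (cancel_mono e.hom).mp (h2.trans Limits.zero_comp.symm)

variable {J : CochainComplex C ℤ}

theorem ExtVanish.mono {K : CochainComplex C ℤ} {m n : ℤ} (h : ExtVanish J K m) (hmn : m ≤ n) :
    ExtVanish J K n := fun i hi ↦ h i (by omega)

theorem ExtVanish.of_retract {K L : CochainComplex C ℤ} {n : ℤ} (h : ExtVanish J L n)
    (i : Q.obj K ⟶ Q.obj L) (r : Q.obj L ⟶ Q.obj K) (hir : i ≫ r = 𝟙 _) : ExtVanish J K n :=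
  fun j hj f ↦ by rw [← Category.id_comp f, ← hir, Category.assoc, h j hj (r ≫ f), Limits.comp_zero]

theorem ExtVanish.of_iso {K L : CochainComplex C ℤ} {n : ℤ} (h : ExtVanish J L n)
    (e : Q.obj K ≅ Q.obj L) : ExtVanish J K n := h.of_retract e.hom e.inv e.hom_inv_id

theorem ExtVanish.of_quasiIso {K L : CochainComplex C ℤ} {n : ℤ} (f : K ⟶ L) [QuasiIso f]
    (h : ExtVanish J L n) : ExtVanish J K n := h.of_iso (asIso (Q.map f))

theorem ExtVanish.of_quasiIso' {K L : CochainComplex C ℤ} {n : ℤ} (f : K ⟶ L) [QuasiIso f]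
    (h : ExtVanish J K n) : ExtVanish J L n := h.of_iso (asIso (Q.map f)).symm

theorem extVanish_of_isZero {K : CochainComplex C ℤ} (hK : Limits.IsZero K) (n : ℤ) :
    ExtVanish J K n := fun _ _ _ ↦ (Q.map_isZero hK).eq_of_src _ _

section ShortExact

variable {S : ShortComplex (CochainComplex C ℤ)} (hS : S.ShortExact) {n : ℤ}

include hS

theorem ExtVanish.middle (h₁ : ExtVanish J S.X₁ n) (h₃ : ExtVanish J S.X₃ n) :
    ExtVanish J S.X₂ n := by
  intro i hi f
  obtain ⟨g, rfl⟩ := Triangle.yoneda_exact₂ _ (triangleOfSES_distinguished hS) f (h₁ i hi _)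
  rw [show g = 0 from h₃ i hi _]
  exact Limits.comp_zero

theorem ExtVanish.right (h₂ : ExtVanish J S.X₂ n) (h₁ : ExtVanish J S.X₁ (n - 1)) :
    ExtVanish J S.X₃ n := by
  intro i hi f
  obtain ⟨g, rfl⟩ := Triangle.yoneda_exact₃ _ (triangleOfSES_distinguished hS) f (h₂ i hi _)
  rw [show g = 0 from eq_zero_of_shift (sub_add_cancel i 1) (h₁ (i - 1) (by omega)) _]
  exact Limits.comp_zero

theorem ExtVanish.left (h₂ : ExtVanish J S.X₂ n) (h₃ : ExtVanish J S.X₃ (n + 1)) :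
    ExtVanish J S.X₁ n := by
  intro i hi f
  let e := (shiftFunctorAdd' (DerivedCategory C) i 1 (i + 1) rfl).app (Q.obj J)
  obtain ⟨g, hg⟩ := Triangle.yoneda_exact₃ _
    (rot_of_distTriang _ (triangleOfSES_distinguished hS)) (f⟦(1 : ℤ)⟧' ≫ e.inv)
    (h₃ (i + 1) (by omega) _)
  have hg0 : g = 0 := eq_zero_of_shift rfl (h₂ i hi) g
  rw [hg0, Limits.comp_zero] at hg
  have := (cancel_mono e.inv).mp (hg.trans Limits.zero_comp.symm)
  exact (shiftFunctor (DerivedCategory C) (1 : ℤ)).map_injective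
    (this.trans (Functor.map_zero _ _ _).symm)

end ShortExact

section KInjective

variable [J.IsKInjective] {K : CochainComplex C ℤ}

theorem forall_eq_zero_iff_coboundaries (i : ℤ) :
    (∀ f : Q.obj K ⟶ (Q.obj J)⟦i⟧, f = 0) ↔ ∀ z : Cocycle K J i, z ∈ coboundaries K J i := by
  have key : ∀ φ :
      (HomotopyCategory.quotient C _).obj K ⟶ (HomotopyCategory.quotient C _).obj (J⟦i⟧),
      Qh.map φ = 0 ↔ φ = 0 := fun φ ↦ by
    constructor
    · intro h
      exact (CochainComplex.IsKInjective.Qh_map_bijective _ (J⟦i⟧)).injective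
        (h.trans (Functor.map_zero _ _ _).symm)
    · rintro rfl
      exact Functor.map_zero _ _ _
  let e := (Q.commShiftIso i).app J
  let a := (quotientCompQhIso C).app K
  let b := (quotientCompQhIso C).app (J⟦i⟧)
  constructor
  · intro h z
    rw [← CohomologyClass.toHom_mk_eq_zero_iff, ← key]
    have := h (a.inv ≫ Qh.map (CohomologyClass.toHom (.mk z)) ≫ b.hom ≫ e.hom)
    have h2 := (cancel_epi a.inv).mp (this.trans Limits.comp_zero.symm)
    exact (cancel_mono (b.hom ≫ e.hom)).mp (h2.trans Limits.zero_comp.symm)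
  · intro h f
    obtain ⟨φ, hφ⟩ := (CochainComplex.IsKInjective.Qh_map_bijective _ (J⟦i⟧)).surjective
      (a.hom ≫ f ≫ e.inv ≫ b.inv)
    obtain ⟨x, rfl⟩ := (CohomologyClass.toHom_bijective K J i).surjective φ
    obtain ⟨z, rfl⟩ := CohomologyClass.mk_surjective x
    rw [(CohomologyClass.toHom_mk_eq_zero_iff z).mpr (h z), Functor.map_zero] at hφ
    have h2 := (cancel_epi a.hom).mp (hφ.symm.trans Limits.comp_zero.symm)
    exact (cancel_mono (e.inv ≫ b.inv)).mp (h2.trans Limits.zero_comp.symm)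

theorem extVanish_of_coproduct {ι : Type*} (L : ι → CochainComplex C ℤ) (inj : ∀ a, L a ⟶ K)
    (desc : ∀ (i : ℤ) (T : C) (f : ∀ a, (L a).X i ⟶ T), ∃ g : K.X i ⟶ T, ∀ a, (inj a).f i ≫ g = f a)
    (hext : ∀ (i : ℤ) (T : C) (f g : K.X i ⟶ T),
      (∀ a, (inj a).f i ≫ f = (inj a).f i ≫ g) → f = g) {n : ℤ}
    (h : ∀ a, ExtVanish J (L a) n) : ExtVanish J K n := by
  intro i hi
  rw [forall_eq_zero_iff_coboundaries]
  intro z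
  have hz : ∀ a, ∃ y : Cochain (L a) J (i - 1),
      δ (i - 1) i y = (Cochain.ofHom (inj a)).comp z.1 (zero_add i) := by
    intro a
    have := (forall_eq_zero_iff_coboundaries i).mp (h a i hi)
      (Cocycle.mk ((Cochain.ofHom (inj a)).comp z.1 (zero_add i)) (i + 1) rfl (by simp))
    obtain ⟨m, hm, y, hy⟩ := this
    obtain rfl : m = i - 1 := by omega
    exact ⟨y, hy⟩
  choose y hy using hz
  have hY : ∀ (p q : ℤ) (hpq : p + (i - 1) = q), ∃ g : K.X p ⟶ J.X q,
      ∀ a, (inj a).f p ≫ g = (y a).v p q hpq := fun p q hpq ↦ desc p _ _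
  choose Y hY using hY
  refine ⟨i - 1, by omega, Cochain.mk Y, ?_⟩
  ext p q hpq
  refine hext p _ _ _ fun a ↦ ?_
  have h1 := Cochain.congr_v (hy a) p q hpq
  rw [δ_v (i - 1) i (by omega) _ p q hpq (q - 1) (p + 1) rfl rfl] at h1 ⊢
  rw [Cochain.zero_cochain_comp_v, Cochain.ofHom_v] at h1
  refine Eq.trans ?_ h1
  rw [Preadditive.comp_add, Linear.comp_units_smul, ← Category.assoc, ← Category.assoc,
    (inj a).comm p (p + 1), Cochain.mk_v, Cochain.mk_v, hY, Category.assoc, hY]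

end KInjective

end DerivedCategory

section Supports

variable {R : Type} [CommRing R]

/-- The submodule of the elements of `E` whose support is contained in `Z`. -/
def supportedIn (Z : Set (PrimeSpectrum R)) (E : Type*) [AddCommGroup E] [Module R E] :
    Submodule R E where
  carrier := {e | ∀ q ∉ Z, ∃ s ∉ q.asIdeal, s • e = 0}
  zero_mem' q _ := ⟨1, q.isPrime.one_notMem, smul_zero _⟩
  add_mem' {a b} ha hb q hq := by
    obtain ⟨s, hs, hsa⟩ := ha q hq
    obtain ⟨t, ht, htb⟩ := hb q hq
    refine ⟨s * t, fun h ↦ (q.isPrime.mem_or_mem h).elim hs ht, ?_⟩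
    rw [smul_add, mul_comm, mul_smul, hsa, smul_zero, mul_comm, mul_smul, htb, smul_zero, add_zero]
  smul_mem' r a ha q hq := by
    obtain ⟨s, hs, hsa⟩ := ha q hq
    exact ⟨s, hs, by rw [smul_comm, hsa, smul_zero]⟩

variable {Z Z' Z'' A B : Set (PrimeSpectrum R)}
variable {E F : Type*} [AddCommGroup E] [Module R E] [AddCommGroup F] [Module R F]

theorem supportedIn_mono (h : Z ⊆ Z') : supportedIn Z E ≤ supportedIn Z' E :=
  fun _ he q hq ↦ he q fun hZ ↦ hq (h hZ)

theorem supportedIn_inter : supportedIn (Z ∩ Z') E = supportedIn Z E ⊓ supportedIn Z' E := by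
  refine le_antisymm (le_inf (supportedIn_mono Set.inter_subset_left)
    (supportedIn_mono Set.inter_subset_right)) fun e ⟨h, h'⟩ q hq ↦ ?_
  by_cases hZ : q ∈ Z
  · exact h' q fun hZ' ↦ hq ⟨hZ, hZ'⟩
  · exact h q hZ

theorem supportedIn_univ : supportedIn (Set.univ : Set (PrimeSpectrum R)) E = ⊤ :=
  top_le_iff.mp fun _ _ _ hq ↦ (hq trivial).elim

theorem supportedIn_empty : supportedIn (∅ : Set (PrimeSpectrum R)) E = ⊥ := by
  refine le_bot_iff.mp fun e he ↦ ?_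
  have : LinearMap.ker (LinearMap.toSpanSingleton R E e) = ⊤ := by
    by_contra h
    obtain ⟨m, hm, hle⟩ := Ideal.exists_le_maximal _ h
    obtain ⟨s, hs, hse⟩ := he ⟨m, hm.isPrime⟩ (Set.notMem_empty _)
    exact hs (hle hse)
  have h1 : (1 : R) ∈ LinearMap.ker (LinearMap.toSpanSingleton R E e) := this ▸ trivial
  simpa using h1

theorem map_mem_supportedIn (f : E →ₗ[R] F) {e : E} (he : e ∈ supportedIn Z E) :
    f e ∈ supportedIn Z F := fun q hq ↦ by
  obtain ⟨s, hs, hse⟩ := he q hq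
  exact ⟨s, hs, by rw [← map_smul, hse, map_zero]⟩

theorem mem_supportedIn_of_forall {e e' : E} (h : ∀ r : R, r • e = 0 → r • e' = 0)
    (he : e ∈ supportedIn Z E) : e' ∈ supportedIn Z E := fun q hq ↦ by
  obtain ⟨s, hs, hse⟩ := he q hq
  exact ⟨s, hs, h s hse⟩

theorem mem_supportedIn_zeroLocus_singleton {x : R} {e : E} :
    e ∈ supportedIn (PrimeSpectrum.zeroLocus {x}) E ↔ ∃ m : ℕ, x ^ m • e = 0 := by
  constructor
  · intro he
    have : x ∈ Ideal.radical (LinearMap.ker (LinearMap.toSpanSingleton R E e)) := by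
      rw [Ideal.radical_eq_sInf, Ideal.mem_sInf]
      rintro P ⟨hle, hP⟩
      by_contra hx
      obtain ⟨s, hs, hse⟩ := he ⟨P, hP⟩ (by simpa using hx)
      exact hs (hle hse)
    obtain ⟨m, hm⟩ := this
    exact ⟨m, hm⟩
  · rintro ⟨m, hm⟩ q hq
    exact ⟨x ^ m, fun h ↦ hq (by simpa using q.isPrime.mem_of_pow_mem m h), hm⟩

theorem PowDivisible.supportedIn (h : PowDivisible R E) : PowDivisible R (supportedIn Z E) := by
  rintro x ⟨w, hw⟩ a
  obtain ⟨w', m, h1, h2⟩ := h x w a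
  exact ⟨⟨w', mem_supportedIn_of_forall h2 hw⟩, m, Subtype.ext h1,
    fun r hr ↦ Subtype.ext (h2 r (congrArg Subtype.val hr))⟩

variable (Z' Z E) in
/-- The quotient of `supportedIn Z' E` by `supportedIn Z E`. -/
abbrev SupportQuot : Type _ :=
  supportedIn Z' E ⧸ (supportedIn Z E).submoduleOf (supportedIn Z' E)

namespace SupportQuot

/-- The class of an element supported in `Z'`. -/
def mk (Z : Set (PrimeSpectrum R)) : supportedIn Z' E →ₗ[R] SupportQuot Z Z' E :=
  Submodule.mkQ _

theorem mk_surjective : Function.Surjective (mk Z : supportedIn Z' E →ₗ[R] _) :=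
  Submodule.mkQ_surjective _

theorem mk_eq_zero {e : supportedIn Z' E} : mk Z e = 0 ↔ (e : E) ∈ supportedIn Z E :=
  Submodule.Quotient.mk_eq_zero _

/-- The functoriality of `SupportQuot` in all the arguments. -/
def map (f : E →ₗ[R] F) (hA : Z ⊆ A) (hB : Z' ⊆ B) : SupportQuot Z Z' E →ₗ[R] SupportQuot A B F :=
  Submodule.mapQ _ _ (f.restrict fun _ h ↦ supportedIn_mono hB (map_mem_supportedIn f h))
    fun _ h ↦ supportedIn_mono hA (map_mem_supportedIn f h)

@[ext] theorem hom_ext {T : Type*} [AddCommGroup T] [Module R T]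
    {f g : SupportQuot Z Z' E →ₗ[R] T} (h : ∀ e, f (mk Z e) = g (mk Z e)) : f = g :=
  LinearMap.ext fun x ↦ by
    obtain ⟨e, rfl⟩ := mk_surjective x
    exact h e

end SupportQuot

/-- `supportedIn Z` as a functor. -/
@[simps]
def supportFunctor (Z : Set (PrimeSpectrum R)) : ModuleCat.{0} R ⥤ ModuleCat.{0} R where
  obj E := ModuleCat.of R (supportedIn Z E)
  map f := ModuleCat.ofHom (f.hom.restrict fun _ h ↦ map_mem_supportedIn f.hom h)

instance : (supportFunctor Z).Additive where

/-- `SupportQuot Z Z'` as a functor. -/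
@[simps]
def supportQuotFunctor (Z Z' : Set (PrimeSpectrum R)) : ModuleCat.{0} R ⥤ ModuleCat.{0} R where
  obj E := ModuleCat.of R (SupportQuot Z Z' E)
  map f := ModuleCat.ofHom (SupportQuot.map f.hom subset_rfl subset_rfl)
  map_id E := by
    ext1
    exact SupportQuot.hom_ext fun e ↦ rfl
  map_comp f g := by
    ext1
    exact SupportQuot.hom_ext fun e ↦ rfl

instance : (supportQuotFunctor Z Z').Additive where
  map_add {_ _} f g := by
    ext1
    exact SupportQuot.hom_ext fun e ↦ rfl

/-- The inclusion of `supportedIn Z` in `supportedIn Z'`. -/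
@[simps]
def supportFunctorMap (h : Z ⊆ Z') : supportFunctor Z ⟶ supportFunctor Z' where
  app E := ModuleCat.ofHom (Submodule.inclusion (supportedIn_mono h))

/-- The projection of `supportedIn Z'` on `SupportQuot Z Z'`. -/
@[simps]
def supportQuotFunctorMk (Z Z' : Set (PrimeSpectrum R)) :
    supportFunctor Z' ⟶ supportQuotFunctor Z Z' where
  app E := ModuleCat.ofHom (SupportQuot.mk Z)

/-- The natural map between the quotients `SupportQuot`. -/
@[simps]
def supportQuotFunctorMap (hA : Z ⊆ A) (hB : Z' ⊆ B) :
    supportQuotFunctor Z Z' ⟶ supportQuotFunctor A B where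
  app E := ModuleCat.ofHom (SupportQuot.map LinearMap.id hA hB)
  naturality E F f := by
    ext1
    exact SupportQuot.hom_ext fun e ↦ rfl

end Supports

section DirectSum

variable {R : Type*} [CommRing R] {ι : Type*} [DecidableEq ι] {N : ι → Type*}
  [∀ a, AddCommGroup (N a)] [∀ a, Module R (N a)] {M T : Type*} [AddCommGroup M] [Module R M]
  [AddCommGroup T] [Module R T] {φ : ∀ a, N a →ₗ[R] M}
  (hφ : Function.Bijective (DirectSum.toModule R ι M φ))

include hφ

theorem exists_linearMap_of_bijective_toModule (f : ∀ a, N a →ₗ[R] T) :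
    ∃ g : M →ₗ[R] T, ∀ a x, g (φ a x) = f a x := by
  let e := LinearEquiv.ofBijective _ hφ
  refine ⟨(DirectSum.toModule R ι T f) ∘ₗ e.symm.toLinearMap, fun a x ↦ ?_⟩
  have : e.symm (φ a x) = DirectSum.lof R ι N a x := by
    rw [LinearEquiv.symm_apply_eq]
    exact (DirectSum.toModule_lof R a x).symm
  exact (congrArg _ this).trans (DirectSum.toModule_lof R a x)

theorem linearMap_ext_of_bijective_toModule {f g : M →ₗ[R] T}
    (h : ∀ a x, f (φ a x) = g (φ a x)) : f = g := by
  have : f ∘ₗ DirectSum.toModule R ι M φ = g ∘ₗ DirectSum.toModule R ι M φ :=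
    DirectSum.linearMap_ext R fun a ↦ LinearMap.ext fun x ↦ by simpa using h a x
  ext x
  obtain ⟨y, rfl⟩ := hφ.2 x
  exact LinearMap.congr_fun this y

end DirectSum

section Functors

open DerivedCategory

universe w

variable {R : Type} [CommRing R] {K : CochainComplex (ModuleCat.{0} R) ℤ}
  {F₁ F₂ F₃ : ModuleCat.{0} R ⥤ ModuleCat.{0} R} [F₁.Additive] [F₂.Additive] [F₃.Additive]

/-- A pair of natural transformations is short exact on the terms of `K`. -/
structure ShortExactOn (K : CochainComplex (ModuleCat.{0} R) ℤ) (α : F₁ ⟶ F₂) (β : F₂ ⟶ F₃) :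
    Prop where
  injective (i : ℤ) : Function.Injective (α.app (K.X i))
  exact (i : ℤ) : Function.Exact (α.app (K.X i)) (β.app (K.X i))
  surjective (i : ℤ) : Function.Surjective (β.app (K.X i))

namespace ShortExactOn

variable {α : F₁ ⟶ F₂} {β : F₂ ⟶ F₃} (h : ShortExactOn K α β)

include h

theorem comp_eq_zero : (NatTrans.mapHomologicalComplex α (ComplexShape.up ℤ)).app K ≫
    (NatTrans.mapHomologicalComplex β (ComplexShape.up ℤ)).app K = 0 := by
  ext i x
  exact (h.exact i).apply_apply_eq_zero x

theorem shortExact : (ShortComplex.mk _ _ h.comp_eq_zero).ShortExact := by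
  refine HomologicalComplex.shortExact_of_degreewise_shortExact _ fun i ↦ ?_
  exact ModuleCat.shortComplex_shortExact _ (h.exact i) (h.injective i) (h.surjective i)

end ShortExactOn

variable {Z Z' Z'' : Set (PrimeSpectrum R)}

theorem shortExactOn_support (h : Z ⊆ Z') :
    ShortExactOn K (supportFunctorMap h) (supportQuotFunctorMk Z Z') where
  injective i := Submodule.inclusion_injective (supportedIn_mono h)
  exact i e := by
    refine (SupportQuot.mk_eq_zero (E := K.X i)).trans ⟨fun he ↦ ⟨⟨e.1, he⟩, rfl⟩, ?_⟩
    rintro ⟨e, rfl⟩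
    exact e.2
  surjective i := SupportQuot.mk_surjective

theorem shortExactOn_supportQuot (h : Z ⊆ Z') (h' : Z' ⊆ Z'') :
    ShortExactOn K (supportQuotFunctorMap (A := Z) subset_rfl h')
      (supportQuotFunctorMap h subset_rfl) where
  injective i := by
    refine (injective_iff_map_eq_zero _).mpr fun x hx ↦ ?_
    obtain ⟨e, rfl⟩ := SupportQuot.mk_surjective x
    exact SupportQuot.mk_eq_zero.mpr ((SupportQuot.mk_eq_zero (E := K.X i)).mp hx :)
  exact i x := by
    obtain ⟨e, rfl⟩ := SupportQuot.mk_surjective x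
    refine (SupportQuot.mk_eq_zero (E := K.X i)).trans
      ⟨fun he ↦ ⟨SupportQuot.mk Z ⟨e.1, he⟩, rfl⟩, ?_⟩
    rintro ⟨y, hy⟩
    obtain ⟨e', rfl⟩ := SupportQuot.mk_surjective y
    have h2 : (e : K.X i) - e' ∈ supportedIn Z (K.X i) :=
      (Submodule.Quotient.eq ((supportedIn Z (K.X i)).submoduleOf (supportedIn Z'' (K.X i)))).mp
        (show SupportQuot.mk Z _ = SupportQuot.mk Z ⟨e'.1, supportedIn_mono h' e'.2⟩ from hy.symm)
    have h3 := add_mem (supportedIn_mono h h2) e'.2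
    rwa [sub_add_cancel] at h3
  surjective i x := by
    obtain ⟨e, rfl⟩ := SupportQuot.mk_surjective x
    exact ⟨SupportQuot.mk Z e, rfl⟩

variable [HasDerivedCategory.{w} (ModuleCat.{0} R)] {J : CochainComplex (ModuleCat.{0} R) ℤ}

/-- `ExtVanish` for the complex obtained by applying an additive functor to `K`. -/
abbrev ExtVanishOn (J K : CochainComplex (ModuleCat.{0} R) ℤ)
    (F : ModuleCat.{0} R ⥤ ModuleCat.{0} R) [F.Additive] (n : ℤ) : Prop :=
  ExtVanish J ((F.mapHomologicalComplex (ComplexShape.up ℤ)).obj K) n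

theorem ExtVanishOn.of_natIso (e : F₁ ≅ F₂) {n : ℤ} (h : ExtVanishOn J K F₂ n) :
    ExtVanishOn J K F₁ n :=
  ExtVanish.of_iso h (Q.mapIso ((NatIso.mapHomologicalComplex e (ComplexShape.up ℤ)).app K))

section ShortExactOn

variable {α : F₁ ⟶ F₂} {β : F₂ ⟶ F₃} (h : ShortExactOn K α β)

include h

theorem ShortExactOn.middle {n : ℤ} (h₁ : ExtVanishOn J K F₁ n) (h₃ : ExtVanishOn J K F₃ n) :
    ExtVanishOn J K F₂ n := ExtVanish.middle h.shortExact h₁ h₃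

theorem ShortExactOn.right {n : ℤ} (h₂ : ExtVanishOn J K F₂ n) (h₁ : ExtVanishOn J K F₁ (n - 1)) :
    ExtVanishOn J K F₃ n := ExtVanish.right h.shortExact h₂ h₁

theorem ShortExactOn.left {n : ℤ} (h₂ : ExtVanishOn J K F₂ n) (h₃ : ExtVanishOn J K F₃ (n + 1)) :
    ExtVanishOn J K F₁ n := ExtVanish.left h.shortExact h₂ h₃

end ShortExactOn

theorem ExtVanishOn.of_directSum [J.IsKInjective] {ι : Type*} [DecidableEq ι]
    {G : ι → ModuleCat.{0} R ⥤ ModuleCat.{0} R} [∀ a, (G a).Additive] (φ : ∀ a, G a ⟶ F₁)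
    (hφ : ∀ i : ℤ, Function.Bijective (DirectSum.toModule R ι (F₁.obj (K.X i))
      fun a ↦ ((φ a).app (K.X i)).hom)) {n : ℤ} (h : ∀ a, ExtVanishOn J K (G a) n) :
    ExtVanishOn J K F₁ n := by
  refine extVanish_of_coproduct _
    (fun a ↦ (NatTrans.mapHomologicalComplex (φ a) (ComplexShape.up ℤ)).app K) ?_ ?_ h
  · intro i T f
    obtain ⟨g, hg⟩ := exists_linearMap_of_bijective_toModule (hφ i) fun a ↦ (f a).hom
    exact ⟨ModuleCat.ofHom g, fun a ↦ by ext x; exact hg a x⟩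
  · intro i T f g hfg
    ext1
    exact linearMap_ext_of_bijective_toModule (hφ i)
      fun a x ↦ ConcreteCategory.congr_hom (hfg a) x

end Functors

section Telescope

variable {R : Type} [CommRing R] (x : R) (E : Type) [AddCommGroup E] [Module R E]

/-- The endomorphism `(e₀, e₁, …) ↦ (e₁ - x e₀, e₂ - x e₁, …)` of the finite sequences in `E`. -/
def telescope : (ℕ →₀ E) →ₗ[R] (ℕ →₀ E) :=
  Finsupp.lcomapDomain Nat.succ Nat.succ_injective - x • LinearMap.id

variable {E}

theorem telescope_apply (f : ℕ →₀ E) (i : ℕ) : telescope x E f i = f (i + 1) - x • f i := rfl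

theorem telescope_single_succ (i : ℕ) (e : E) :
    telescope x E (Finsupp.single (i + 1) e) =
      Finsupp.single i e - Finsupp.single (i + 1) (x • e) := by
  ext j
  rw [telescope_apply]
  simp [Finsupp.single_apply]

theorem telescope_single_zero (e : E) :
    telescope x E (Finsupp.single 0 e) = - Finsupp.single 0 (x • e) := by
  ext j
  rw [telescope_apply]
  simp [Finsupp.single_apply]

theorem telescope_surjective (hE : PowDivisible R E) : Function.Surjective (telescope x E) := by
  have h0 : ∀ (i : ℕ) (e : E),
      Finsupp.single i (x ^ (i + 1) • e) ∈ LinearMap.range (telescope x E) := by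
    intro i
    induction i with
    | zero =>
      intro e
      exact ⟨Finsupp.single 0 (-e), by simp [telescope_single_zero]⟩
    | succ i ih =>
      intro e
      have := sub_mem (ih e) ⟨Finsupp.single (i + 1) (x ^ (i + 1) • e), telescope_single_succ x i _⟩
      rwa [sub_sub_cancel, smul_smul, ← pow_succ'] at this
  have h1 : ∀ (m j : ℕ) (e : E),
      Finsupp.single (j + m) (x ^ m • e) ∈ LinearMap.range (telescope x E) →
        Finsupp.single j e ∈ LinearMap.range (telescope x E) := by
    intro m
    induction m with
    | zero => intro j e h; simpa using h
    | succ m ih =>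
      intro j e h
      refine ih j e ?_
      have := add_mem h ⟨Finsupp.single (j + m + 1) (x ^ m • e), telescope_single_succ x _ _⟩
      rw [smul_smul, ← pow_succ', ← add_assoc, add_sub_cancel] at this
      exact this
  refine LinearMap.range_eq_top.mp (top_le_iff.mp fun f _ ↦ ?_)
  induction f using Finsupp.induction_linear with
  | zero => exact zero_mem _
  | add f g hf hg => exact add_mem (hf trivial) (hg trivial)
  | single j e =>
    obtain ⟨e', m, h, -⟩ := hE x e (j + 1)
    refine h1 m j e ?_
    rw [← h, show m + (j + 1) = (j + m) + 1 by omega]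
    exact h0 _ _

variable (A : Set (PrimeSpectrum R)) (E)

/-- The map `e ↦ (e, x e, x² e, …)` on the elements killed by a power of `x`. -/
def powSequence : supportedIn (A ∩ PrimeSpectrum.zeroLocus {x}) E →ₗ[R] (ℕ →₀ supportedIn A E) where
  toFun e := Finsupp.ofSupportFinite
    (fun i ↦ x ^ i • (⟨e.1, supportedIn_mono Set.inter_subset_left e.2⟩ : supportedIn A E)) (by
      obtain ⟨m, hm⟩ := mem_supportedIn_zeroLocus_singleton.mp
        (supportedIn_mono Set.inter_subset_right e.2)
      refine (Set.finite_lt_nat m).subset fun i hi ↦ ?_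
      by_contra h
      refine hi (Subtype.ext ?_)
      have : x ^ i • (e : E) = x ^ (i - m) • x ^ m • (e : E) := by
        rw [smul_smul, ← pow_add, Nat.sub_add_cancel (not_lt.mp h)]
      exact this.trans (by rw [hm, smul_zero]; rfl))
  map_add' a b := by
    ext i
    exact smul_add _ _ _
  map_smul' r a := by
    ext i
    exact smul_comm _ _ _

theorem powSequence_apply (e : supportedIn (A ∩ PrimeSpectrum.zeroLocus {x}) E) (i : ℕ) :
    (powSequence x E A e i : E) = x ^ i • (e : E) := rfl

theorem powSequence_injective : Function.Injective (powSequence x E A) := fun a b h ↦ by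
  have := congrArg Subtype.val (DFunLike.congr_fun h 0)
  rw [powSequence_apply, powSequence_apply, pow_zero, one_smul, one_smul] at this
  exact Subtype.ext this

theorem powSequence_exact :
    Function.Exact (powSequence x E A) (telescope x (supportedIn A E)) := by
  intro f
  constructor
  · intro h
    have h' : ∀ i, f (i + 1) = x • f i := fun i ↦
      sub_eq_zero.mp ((telescope_apply x f i).symm.trans (DFunLike.congr_fun h i))
    have h'' : ∀ i, f i = x ^ i • f 0 := by
      intro i
      induction i with
      | zero => simp
      | succ i ih => rw [h', ih, smul_smul, ← pow_succ']
    obtain ⟨m, hm⟩ := Infinite.exists_notMem_finset f.support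
    have h0 : x ^ m • (f 0 : E) = 0 :=
      congrArg Subtype.val ((h'' m).symm.trans (Finsupp.notMem_support_iff.mp hm))
    refine ⟨⟨f 0, ?_⟩, ?_⟩
    · rw [supportedIn_inter]
      exact ⟨(f 0).2, mem_supportedIn_zeroLocus_singleton.mpr ⟨m, h0⟩⟩
    · ext i
      rw [powSequence_apply]
      exact congrArg Subtype.val (h'' i).symm
  · rintro ⟨e, rfl⟩
    ext i
    rw [telescope_apply]
    simp [powSequence_apply, smul_smul, pow_succ']

end Telescope

section

open DerivedCategory

universe w

variable {R : Type} [CommRing R]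

/-- The functor of finite sequences. -/
@[simps]
def finsuppFunctor (R : Type) [CommRing R] : ModuleCat.{0} R ⥤ ModuleCat.{0} R where
  obj E := ModuleCat.of R (ℕ →₀ E)
  map f := ModuleCat.ofHom (Finsupp.mapRange.linearMap f.hom)

instance : (finsuppFunctor R).Additive where
  map_add {E F} f g := by
    ext1
    refine LinearMap.ext fun (e : ℕ →₀ E) ↦ Finsupp.ext fun j ↦ rfl

/-- `powSequence` as a natural transformation. -/
@[simps]
def powSequenceNat (x : R) (A : Set (PrimeSpectrum R)) :
    supportFunctor (A ∩ PrimeSpectrum.zeroLocus {x}) ⟶ supportFunctor A ⋙ finsuppFunctor R where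
  app E := ModuleCat.ofHom (powSequence x E A)
  naturality E F f := by
    ext1
    refine LinearMap.ext fun e ↦ Finsupp.ext fun j ↦ ?_
    exact Subtype.ext (map_smul f.hom (x ^ j) e.1).symm

/-- `telescope` as a natural transformation. -/
@[simps]
def telescopeNat (x : R) : finsuppFunctor R ⟶ finsuppFunctor R where
  app E := ModuleCat.ofHom (telescope x E)
  naturality E F f := by
    ext1
    refine LinearMap.ext fun (e : ℕ →₀ E) ↦ Finsupp.ext fun j ↦ ?_
    refine Eq.trans ?_ (map_sub f.hom (e (j + 1)) (x • e j)).symm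
    rw [map_smul]
    rfl

variable {K : CochainComplex (ModuleCat.{0} R) ℤ}

theorem shortExactOn_telescope (hK : ∀ i, PowDivisible R (K.X i)) (x : R)
    (A : Set (PrimeSpectrum R)) :
    ShortExactOn K (powSequenceNat x A)
      (Functor.whiskerLeft (supportFunctor A) (telescopeNat x)) where
  injective i := powSequence_injective x (K.X i) A
  exact i := powSequence_exact x (K.X i) A
  surjective i := telescope_surjective x (hK i).supportedIn

variable [HasDerivedCategory.{w} (ModuleCat.{0} R)] {J : CochainComplex (ModuleCat.{0} R) ℤ}
  [J.IsKInjective]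

theorem ExtVanishOn.finsupp {F : ModuleCat.{0} R ⥤ ModuleCat.{0} R} [F.Additive] {n : ℤ}
    (h : ExtVanishOn J K F n) : ExtVanishOn J K (F ⋙ finsuppFunctor R) n := by
  refine ExtVanishOn.of_directSum (ι := ℕ) (G := fun _ ↦ F)
    (fun a ↦ { app := fun E ↦ ModuleCat.ofHom (Finsupp.lsingle a), naturality := ?_ }) ?_ fun _ ↦ h
  · intro E E' f
    ext1
    exact LinearMap.ext fun e ↦
      (Finsupp.mapRange_single (f := (F.map f).hom) (hf := map_zero _)).symm
  · intro i
    have : (DirectSum.toModule R ℕ (ℕ →₀ F.obj (K.X i)) fun a ↦ Finsupp.lsingle a) =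
        (finsuppLEquivDirectSum R (F.obj (K.X i)) ℕ).symm.toLinearMap := by
      refine DirectSum.linearMap_ext R fun a ↦ LinearMap.ext fun e ↦ ?_
      simp
    exact (congrArg (fun g : _ →ₗ[R] _ ↦ Function.Bijective g) this).mpr
      (finsuppLEquivDirectSum R (F.obj (K.X i)) ℕ).symm.bijective

theorem ExtVanishOn.inter_zeroLocus_singleton (hK : ∀ i, PowDivisible R (K.X i)) {x : R}
    {A : Set (PrimeSpectrum R)} {n : ℤ} (h : ExtVanishOn J K (supportFunctor A) n) :
    ExtVanishOn J K (supportFunctor (A ∩ PrimeSpectrum.zeroLocus {x})) n :=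
  (shortExactOn_telescope hK x A).left h.finsupp (ExtVanish.mono h.finsupp (by omega))

theorem ExtVanishOn.zeroLocus (hK : ∀ i, PowDivisible R (K.X i)) {n : ℤ}
    (h : ExtVanishOn J K (supportFunctor Set.univ) n) (s : Finset R) :
    ExtVanishOn J K (supportFunctor (PrimeSpectrum.zeroLocus (s : Set R))) n := by
  classical
  induction s using Finset.induction_on with
  | empty =>
    rw [Finset.coe_empty, PrimeSpectrum.zeroLocus_empty]
    exact h
  | insert x s hx ih =>
    rw [Finset.coe_insert, Set.insert_eq, Set.union_comm, PrimeSpectrum.zeroLocus_union]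
    exact ih.inter_zeroLocus_singleton hK

end

section DirectSum

variable {R : Type*} [CommRing R] {ι : Type*} [DecidableEq ι] {N : ι → Type*}
  [∀ a, AddCommGroup (N a)] [∀ a, Module R (N a)] {M : Type*} [AddCommGroup M] [Module R M]
  (φ : ∀ a, N a →ₗ[R] M)

theorem mem_range_toModule (a : ι) (x : N a) :
    φ a x ∈ LinearMap.range (DirectSum.toModule R ι M φ) :=
  ⟨DirectSum.lof R ι N a x, DirectSum.toModule_lof R a x⟩

theorem toModule_injective_of_projections {P : ι → Type*} [∀ a, AddCommGroup (P a)]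
    [∀ a, Module R (P a)] (π : ∀ a, M →ₗ[R] P a) (h : ∀ a x, π a (φ a x) = 0 → x = 0)
    (h' : ∀ a b, b ≠ a → ∀ x, π a (φ b x) = 0) :
    Function.Injective (DirectSum.toModule R ι M φ) := by
  refine (injective_iff_map_eq_zero _).mpr fun x hx ↦ ?_
  ext1 a
  have h1 : π a ∘ₗ DirectSum.toModule R ι M φ = π a ∘ₗ φ a ∘ₗ DirectSum.component R ι N a := by
    refine DirectSum.linearMap_ext R fun b ↦ LinearMap.ext fun y ↦ ?_
    simp only [LinearMap.comp_apply, DirectSum.toModule_lof]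
    by_cases hb : b = a
    · subst hb
      rw [DirectSum.component.lof_self]
    · rw [DirectSum.component.of, dif_neg hb, map_zero, map_zero, h' a b hb]
  have h2 := LinearMap.congr_fun h1 x
  rw [LinearMap.comp_apply, hx, map_zero] at h2
  exact h a _ h2.symm

end DirectSum

section Decomposition

variable {R : Type} [CommRing R] {E : Type} [AddCommGroup E] [Module R E]

theorem exists_mem_supportedIn_Ici_of_isPrimary {Z : Set (PrimeSpectrum R)} {e g : E}
    (he : e ∈ supportedIn Z E) {Q : Ideal R} (hQ : Q.IsPrimary) (hann : ∀ r : R, r • e = 0 → r ∈ Q)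
    (hg : ∀ r ∈ Q, r • g = 0) : ∃ q ∈ Z, g ∈ supportedIn (Set.Ici q) E := by
  refine ⟨⟨Q.radical, Ideal.isPrime_radical hQ⟩, ?_, ?_⟩
  · by_contra hq
    obtain ⟨r, hr, hre⟩ := he _ hq
    exact hr (Ideal.le_radical (hann r hre))
  · intro q' hq'
    obtain ⟨r, ⟨n, hn⟩, hr'⟩ := Set.not_subset.mp hq'
    exact ⟨r ^ n, fun h ↦ hr' (q'.isPrime.mem_of_pow_mem n h), hg _ hn⟩

open Classical in
theorem bijective_toModule_supportQuot [IsNoetherianRing R] (hE : Module.Baer R E)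
    {Z Z' : Set (PrimeSpectrum R)} (hZ : IsUpperSet Z) (hZ' : IsUpperSet Z')
    (hlt : ∀ q : (Z' \ Z : Set (PrimeSpectrum R)), Set.Ioi q.1 ⊆ Z)
    (hle : ∀ q : (Z' \ Z : Set (PrimeSpectrum R)), Set.Ici q.1 ⊆ Z') :
    Function.Bijective (DirectSum.toModule R (Z' \ Z : Set (PrimeSpectrum R)) (SupportQuot Z Z' E)
      fun q ↦ SupportQuot.map LinearMap.id (hlt q) (hle q)) := by
  constructor
  · refine toModule_injective_of_projections _ (P := fun q ↦ SupportQuot (Z' \ {q.1} ∪ Z) Z' E)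
      (fun q ↦ SupportQuot.map LinearMap.id Set.subset_union_right subset_rfl) ?_ ?_
    · intro q x hx
      obtain ⟨e, rfl⟩ := SupportQuot.mk_surjective x
      have h3 : (e : E) ∈ supportedIn (Z' \ {q.1} ∪ Z) E :=
        (SupportQuot.mk_eq_zero (E := E)
          (e := ⟨e, supportedIn_mono (hle q) e.2⟩)).mp hx
      have h4 : (e : E) ∈ supportedIn (Set.Ici q.1 ∩ (Z' \ {q.1} ∪ Z)) E := by
        rw [supportedIn_inter]
        exact ⟨e.2, h3⟩
      refine SupportQuot.mk_eq_zero.mpr (supportedIn_mono ?_ h4)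
      rintro a ⟨ha, ha'⟩
      refine lt_of_le_of_ne (Set.mem_Ici.mp ha) ?_
      rintro rfl
      exact ha'.elim (fun h ↦ h.2 rfl) q.2.2
    · intro q q' h x
      obtain ⟨e, rfl⟩ := SupportQuot.mk_surjective x
      refine (SupportQuot.mk_eq_zero (E := E)).mpr (supportedIn_mono ?_ e.2)
      intro a ha
      rcases eq_or_lt_of_le (Set.mem_Ici.mp ha) with rfl | ha'
      · exact Or.inl ⟨q'.2.1, fun h' ↦ h (Subtype.ext h')⟩
      · exact Or.inr (hlt q' ha')
  · rw [← LinearMap.range_eq_top, ← top_le_iff]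
    rintro y -
    obtain ⟨e, rfl⟩ := SupportQuot.mk_surjective y
    obtain ⟨s, g, hprim, hann, hg, hsum⟩ := exists_primary_sum_of_injective hE (e : E)
    have hmem : ∀ Q ∈ s, ∃ q ∈ Z', g Q ∈ supportedIn (Set.Ici q) E := fun Q hQ ↦
      exists_mem_supportedIn_Ici_of_isPrimary e.2 (hprim Q hQ) (hann Q hQ) (hg Q hQ)
    have hgZ' : ∀ Q ∈ s, g Q ∈ supportedIn Z' E := fun Q hQ ↦ by
      obtain ⟨q, hq, hgq⟩ := hmem Q hQ
      exact supportedIn_mono (fun a ha ↦ hZ' ha hq) hgq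
    have he : e = ∑ Q ∈ s.attach, (⟨g Q, hgZ' Q Q.2⟩ : supportedIn Z' E) := by
      refine Subtype.ext (hsum.trans ?_)
      rw [AddSubmonoidClass.coe_finsetSum, ← Finset.sum_attach]
    rw [he, map_sum]
    refine sum_mem fun Q _ ↦ ?_
    obtain ⟨q, hq, hgq⟩ := hmem Q Q.2
    by_cases hqZ : q ∈ Z
    · have : SupportQuot.mk Z (⟨g Q, hgZ' Q Q.2⟩ : supportedIn Z' E) = 0 :=
        SupportQuot.mk_eq_zero.mpr (supportedIn_mono (fun a ha ↦ hZ ha hqZ) hgq)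
      rw [this]
      exact zero_mem _
    · exact mem_range_toModule (fun q : (Z' \ Z : Set (PrimeSpectrum R)) ↦
        SupportQuot.map LinearMap.id (hlt q) (hle q)) ⟨q, hq, hqZ⟩ (SupportQuot.mk _ ⟨g Q, hgq⟩)

end Decomposition

section

open DerivedCategory

universe w

variable {R : Type} [CommRing R] {K J : CochainComplex (ModuleCat.{0} R) ℤ}
  [HasDerivedCategory.{w} (ModuleCat.{0} R)]

theorem ExtVanishOn.of_subsingleton {F : ModuleCat.{0} R ⥤ ModuleCat.{0} R} [F.Additive]
    (h : ∀ i, Subsingleton (F.obj (K.X i))) (n : ℤ) : ExtVanishOn J K F n := by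
  refine extVanish_of_isZero ?_ n
  rw [Limits.IsZero.iff_id_eq_zero]
  ext i x
  exact (h i).elim _ _

variable [IsNoetherianRing R] [J.IsKInjective]

theorem extVanishOn_supportQuotFunctor (hK : ∀ i, Module.Baer R (K.X i))
    (h : ExtVanishOn J K (supportFunctor Set.univ) 0) (j : ℕ) :
    ∀ (Z Z' : Set (PrimeSpectrum R)), IsUpperSet Z → IsUpperSet Z' → Z ⊆ Z' →
      (∀ q ∈ Z', q ∉ Z → Order.coheight q < j) →
      ExtVanishOn J K (supportQuotFunctor Z Z') (j - 1) := by
  classical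
  induction j with
  | zero =>
    intro Z Z' _ _ hZ hj
    have : Z' ⊆ Z := fun q hq ↦ by
      by_contra hq'
      simpa using hj q hq hq'
    refine ExtVanishOn.of_subsingleton (fun i ↦ ?_) _
    refine subsingleton_of_forall_eq 0 fun x ↦ ?_
    obtain ⟨e, rfl⟩ := SupportQuot.mk_surjective x
    exact SupportQuot.mk_eq_zero.mpr (supportedIn_mono this e.2)
  | succ j ih =>
    intro Z Z' hZ hZ' hle hj
    let Z'' : Set (PrimeSpectrum R) := Z ∪ {q | q ∈ Z' ∧ Order.coheight q < j}
    have h1 : Z ⊆ Z'' := Set.subset_union_left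
    have h2 : Z'' ⊆ Z' := Set.union_subset hle fun q hq ↦ hq.1
    have hZ'' : IsUpperSet Z'' := hZ.union fun a b hab ha ↦
      ⟨hZ' hab ha.1, (Order.coheight_anti hab).trans_lt ha.2⟩
    have hco : ∀ q : (Z' \ Z'' : Set (PrimeSpectrum R)), Order.coheight q.1 = j := by
      intro q
      have ha := hj q q.2.1 fun h ↦ q.2.2 (Or.inl h)
      have hb : ¬ Order.coheight q.1 < j := fun h ↦ q.2.2 (Or.inr ⟨q.2.1, h⟩)
      refine le_antisymm (ENat.lt_natCast_add_one_iff.mp (by exact_mod_cast ha)) (not_lt.mp hb)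
    have hco' : ∀ q : (Z' \ Z'' : Set (PrimeSpectrum R)), ∀ q' ∈ Set.Ioi q.1,
        Order.coheight q' < j := by
      intro q q' hq'
      rw [← hco q]
      exact Order.coheight_strictAnti hq' (by
        refine ((Order.coheight_anti hq'.le).trans (hco q).le).trans_lt (ENat.natCast_lt_top _))
    have hIoi : ∀ q : (Z' \ Z'' : Set (PrimeSpectrum R)), Set.Ioi q.1 ⊆ Z'' := fun q q' hq' ↦
      Or.inr ⟨hZ' hq'.le q.2.1, hco' q q' hq'⟩
    have hIci : ∀ q : (Z' \ Z'' : Set (PrimeSpectrum R)), Set.Ici q.1 ⊆ Z' := fun q q' hq' ↦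
      hZ' hq' q.2.1
    push_cast
    rw [add_sub_cancel_right]
    refine (shortExactOn_supportQuot h1 h2).middle
      (ExtVanish.mono (ih Z Z'' hZ hZ'' h1 fun q hq hq' ↦ (hq.resolve_left hq').2) (by omega)) ?_
    refine ExtVanishOn.of_directSum (fun q ↦ supportQuotFunctorMap (hIoi q) (hIci q))
      (fun i ↦ bijective_toModule_supportQuot (hK i) hZ'' hZ' hIoi hIci) fun q ↦ ?_
    refine (shortExactOn_support Set.Ioi_subset_Ici_self).right ?_ ?_
    · obtain ⟨s, hs⟩ := (isNoetherianRing_iff_ideal_fg R).mp inferInstance q.1.asIdeal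
      have := ExtVanishOn.zeroLocus (fun i ↦ PowDivisible.of_injective (hK i)) h s
      have hs' : PrimeSpectrum.zeroLocus (s : Set R) = Set.Ici q.1 := by
        rw [← PrimeSpectrum.zeroLocus_span]
        exact (congrArg (fun I : Ideal R ↦ PrimeSpectrum.zeroLocus (I : Set R)) hs).trans rfl
      rw [hs'] at this
      exact ExtVanish.mono this (by omega)
    · refine (shortExactOn_support (Set.empty_subset _)).middle
        (ExtVanishOn.of_subsingleton (fun i ↦ ?_) _)
        (ih ∅ (Set.Ioi q.1) isUpperSet_empty (isUpperSet_Ioi _) (Set.empty_subset _)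
          fun q' hq' _ ↦ hco' q q' hq')
      refine subsingleton_of_forall_eq 0 fun x ↦ Subtype.ext ?_
      exact (Submodule.mem_bot R).mp
        ((supportedIn_empty (R := R) (E := K.X i)).le x.2)

end

section Translation

open DerivedCategory CochainComplex.HomComplex

universe w

variable {R : Type} [CommRing R] [HasDerivedCategory.{w} (ModuleCat.{0} R)]
  {M : ModuleCat.{0} R} (I : InjectiveResolution M) (X : ModuleCat.{0} R)

theorem forall_eq_zero_iff_subsingleton_ext (i : ℕ) :
    (∀ f : Q.obj ((CochainComplex.singleFunctor _ 0).obj X) ⟶ (Q.obj I.cochainComplex)⟦(i : ℤ)⟧,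
      f = 0) ↔ Subsingleton (Abelian.Ext X M i) := by
  rw [forall_eq_zero_iff_coboundaries,
    (I.extEquivCohomologyClass (X := X) (n := i)).subsingleton_congr]
  constructor
  · intro h
    refine subsingleton_of_forall_eq 0 fun x ↦ ?_
    obtain ⟨z, rfl⟩ := CohomologyClass.mk_surjective x
    exact (CohomologyClass.mk_eq_zero_iff z).mpr (h z)
  · intro h z
    exact (CohomologyClass.mk_eq_zero_iff z).mp (Subsingleton.elim _ _)

theorem extVanish_iff_subsingleton_ext (n : ℕ) :
    ExtVanish I.cochainComplex ((CochainComplex.singleFunctor _ 0).obj X) n ↔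
      ∀ i, n < i → Subsingleton (Abelian.Ext X M i) := by
  constructor
  · intro h i hi
    exact (forall_eq_zero_iff_subsingleton_ext I X i).mp (h i (by exact_mod_cast hi))
  · intro h i hi
    obtain ⟨i, rfl⟩ := Int.eq_ofNat_of_zero_le (show 0 ≤ i by omega)
    exact (forall_eq_zero_iff_subsingleton_ext I X i).mpr (h i (by exact_mod_cast hi))

end Translation

section Localization

variable {R : Type} [CommRing R] (S : Submonoid R)

/-- Localization of modules, as an endofunctor of the category of modules. -/
@[simps]
def localizationFunctor : ModuleCat.{0} R ⥤ ModuleCat.{0} R where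
  obj E := ModuleCat.of R (LocalizedModule S E)
  map {E F} f := ModuleCat.ofHom (IsLocalizedModule.map S (LocalizedModule.mkLinearMap S E)
    (LocalizedModule.mkLinearMap S F) f.hom)
  map_id E := by
    ext1
    exact IsLocalizedModule.map_id S _
  map_comp {E F G} f g := by
    ext1
    exact IsLocalizedModule.map_comp' S _ (LocalizedModule.mkLinearMap S F) _ f.hom g.hom

instance : (localizationFunctor S).Additive where
  map_add {E F} f g := by
    ext1
    exact map_add (IsLocalizedModule.map S (LocalizedModule.mkLinearMap S E)
      (LocalizedModule.mkLinearMap S F)) f.hom g.hom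

theorem localizationFunctor_map_exact (T : ShortComplex (ModuleCat.{0} R)) (h : T.Exact) :
    (T.map (localizationFunctor S)).Exact := by
  rw [ShortComplex.ShortExact.moduleCat_exact_iff_function_exact] at h ⊢
  exact IsLocalizedModule.map_exact S (LocalizedModule.mkLinearMap S T.X₁)
    (LocalizedModule.mkLinearMap S T.X₂) (LocalizedModule.mkLinearMap S T.X₃) _ _ h

instance : Limits.PreservesFiniteLimits (localizationFunctor S) :=
  (((Functor.exact_tfae (localizationFunctor S)).out 1 3 :
    _ ↔ _ ∧ _).mp (localizationFunctor_map_exact S)).1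

instance : Limits.PreservesFiniteColimits (localizationFunctor S) :=
  (((Functor.exact_tfae (localizationFunctor S)).out 1 3 :
    _ ↔ _ ∧ _).mp (localizationFunctor_map_exact S)).2

variable (p : Ideal R)

/-- The primes not contained in `p`. -/
def notLE : Set (PrimeSpectrum R) := {q | ¬ q.asIdeal ≤ p}

theorem isUpperSet_notLE : IsUpperSet (notLE p) := fun _ _ hab ha hb ↦ ha (le_trans hab hb)

variable [p.IsPrime]

theorem mkLinearMap_eq_zero_iff {E : Type*} [AddCommGroup E] [Module R E] {e : E} :
    LocalizedModule.mkLinearMap p.primeCompl E e = 0 ↔ e ∈ supportedIn (notLE p) E := by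
  rw [IsLocalizedModule.eq_zero_iff p.primeCompl]
  constructor
  · rintro ⟨s, hs⟩ q hq
    exact ⟨s, fun h ↦ s.2 (not_not.mp hq h), hs⟩
  · intro h
    obtain ⟨s, hs, hse⟩ := h ⟨p, inferInstance⟩ (not_not.mpr le_rfl)
    exact ⟨⟨s, hs⟩, hse⟩

/-- The comparison of `SupportQuot (notLE p) Set.univ` with the localization at `p`. -/
def supportQuotToLocalization (E : Type*) [AddCommGroup E] [Module R E] :
    SupportQuot (notLE p) Set.univ E →ₗ[R] LocalizedModule p.primeCompl E :=
  Submodule.liftQ _ (LocalizedModule.mkLinearMap p.primeCompl E ∘ₗ Submodule.subtype _)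
    fun _ h ↦ (mkLinearMap_eq_zero_iff p).mpr h

theorem supportQuotToLocalization_bijective {E : Type*} [AddCommGroup E] [Module R E]
    (hE : PowDivisible R E) : Function.Bijective (supportQuotToLocalization p E) := by
  constructor
  · refine (injective_iff_map_eq_zero _).mpr fun x hx ↦ ?_
    obtain ⟨e, rfl⟩ := SupportQuot.mk_surjective x
    exact SupportQuot.mk_eq_zero.mpr ((mkLinearMap_eq_zero_iff p).mp hx)
  · intro y
    obtain ⟨⟨w, s⟩, rfl⟩ := IsLocalizedModule.mk'_surjective p.primeCompl
      (LocalizedModule.mkLinearMap p.primeCompl E) y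
    obtain ⟨w', m, h, -⟩ := hE s w 1
    refine ⟨SupportQuot.mk _ ⟨w', by rw [supportedIn_univ]; trivial⟩, ?_⟩
    change LocalizedModule.mkLinearMap p.primeCompl E w' = _
    rw [Function.uncurry_apply_pair, eq_comm, IsLocalizedModule.mk'_eq_iff, Submonoid.smul_def,
      ← map_smul, ← sub_eq_zero, ← map_sub, IsLocalizedModule.eq_zero_iff p.primeCompl]
    refine ⟨s ^ m, ?_⟩
    rw [Submonoid.smul_def, smul_sub, sub_eq_zero, smul_smul, SubmonoidClass.coe_pow, ← h, pow_succ]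

/-- `supportQuotToLocalization` as a natural transformation. -/
@[simps]
def supportQuotToLocalizationNat :
    supportQuotFunctor (notLE p) Set.univ ⟶ localizationFunctor p.primeCompl where
  app E := ModuleCat.ofHom (supportQuotToLocalization p E)
  naturality E F f := by
    ext1
    refine SupportQuot.hom_ext fun e ↦ ?_
    exact (IsLocalizedModule.map_apply p.primeCompl (LocalizedModule.mkLinearMap p.primeCompl E)
      (LocalizedModule.mkLinearMap p.primeCompl F) f.hom e).symm

end Localization

section

open DerivedCategory

universe w

variable {R : Type} [CommRing R] {J : CochainComplex (ModuleCat.{0} R) ℤ}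
  [HasDerivedCategory.{w} (ModuleCat.{0} R)]

theorem ExtVanishOn.of_bijective {K : CochainComplex (ModuleCat.{0} R) ℤ}
    {F₁ F₂ : ModuleCat.{0} R ⥤ ModuleCat.{0} R} [F₁.Additive] [F₂.Additive] (θ : F₁ ⟶ F₂)
    (hθ : ∀ i, Function.Bijective (θ.app (K.X i))) {n : ℤ} (h : ExtVanishOn J K F₁ n) :
    ExtVanishOn J K F₂ n := by
  let f := (NatTrans.mapHomologicalComplex θ (ComplexShape.up ℤ)).app K
  have : ∀ i, IsIso (f.f i) := fun i ↦ (ConcreteCategory.isIso_iff_bijective _).mpr (hθ i)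
  have : IsIso f := HomologicalComplex.Hom.isIso_of_components f
  exact ExtVanish.of_quasiIso' f h

end

section

open DerivedCategory

variable {R : Type} [CommRing R]

theorem subsingleton_ext_localization [IsNoetherianRing R] (p : Ideal R) [p.IsPrime]
    (M : ModuleCat.{0} R) (d : ℕ) (hdim : ringKrullDim R = d) (i : ℕ) (hi : d < i) :
    Subsingleton (Abelian.Ext (ModuleCat.of R (Localization.AtPrime p)) M i) := by
  have := HasDerivedCategory.standard (ModuleCat.{0} R)
  let I := injectiveResolution M
  let P := injectiveResolution (ModuleCat.of R R)
  have hK : ∀ i, Module.Baer R (P.cochainComplex.X i) := fun i ↦ baer_of_injective_object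
  have h0 : ExtVanish I.cochainComplex
      ((CochainComplex.singleFunctor _ 0).obj (ModuleCat.of R R)) (0 : ℕ) := by
    rw [extVanish_iff_subsingleton_ext]
    rintro (_ | i) hi
    · omega
    · have : Projective (ModuleCat.of R R) :=
        ModuleCat.projective_of_free (Module.Basis.singleton Unit R)
      exact Abelian.Ext.subsingleton_of_projective _ _ _
  have h1 : ExtVanishOn I.cochainComplex P.cochainComplex (𝟭 _) 0 :=
    ExtVanish.of_iso (ExtVanish.of_quasiIso' P.ι' h0)
      (Q.mapIso ((Functor.mapHomologicalComplexIdIso _ _).app _))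
  have h2 : ExtVanishOn I.cochainComplex P.cochainComplex (supportFunctor Set.univ) 0 := by
    exact ExtVanishOn.of_natIso (NatIso.ofComponents (fun E ↦ LinearEquiv.toModuleIso
      (LinearEquiv.ofTop (supportedIn Set.univ E) supportedIn_univ)) fun f ↦ rfl) h1
  have h3 := extVanishOn_supportQuotFunctor hK h2 (d + 1) (notLE p) Set.univ (isUpperSet_notLE p)
    isUpperSet_univ (Set.subset_univ _) fun q _ _ ↦ by
      have := Order.coheight_le_krullDim q
      rw [show Order.krullDim (PrimeSpectrum R) = d from hdim] at this
      have h : Order.coheight q ≤ d := by exact_mod_cast this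
      exact h.trans_lt (by exact_mod_cast Nat.lt_succ_self d)
  have h4 : ExtVanishOn I.cochainComplex P.cochainComplex (localizationFunctor p.primeCompl) d :=
    ExtVanish.mono (ExtVanishOn.of_bijective (supportQuotToLocalizationNat p)
      (fun i ↦ supportQuotToLocalization_bijective p (PowDivisible.of_injective (hK i))) h3)
      (by omega)
  have h5 := ExtVanish.of_quasiIso
    (((localizationFunctor p.primeCompl).mapHomologicalComplex (ComplexShape.up ℤ)).map P.ι') h4
  let e : ModuleCat.of R (Localization.AtPrime p) ≅
      (localizationFunctor p.primeCompl).obj (ModuleCat.of R R) :=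
    (IsLocalizedModule.linearEquiv p.primeCompl
      (Algebra.linearMap R (Localization.AtPrime p))
      (LocalizedModule.mkLinearMap p.primeCompl R)).toModuleIso
  have h6 : ExtVanish I.cochainComplex ((CochainComplex.singleFunctor _ 0).obj
      (ModuleCat.of R (Localization.AtPrime p))) d :=
    ExtVanish.of_iso h5 (Q.mapIso ((CochainComplex.singleFunctor _ 0).mapIso e ≪≫
      ((HomologicalComplex.singleMapHomologicalComplex _ _ 0).app _).symm))
  exact (extVanish_iff_subsingleton_ext I _ d).mp h6 i hi

end

/-- `R` of finite Krull dimension `d`; if `Ext^n_R(k(p), M) = 0` for some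
`n ≥ 2 · dim R`, then `Ext^i_R(k(p), M) = 0` for all `i ≥ n`. -/
theorem ext_residueField_rigidity_two_dim
    (R : Type) [CommRing R] [IsNoetherianRing R] (p : Ideal R) [p.IsPrime]
    (M : Type) [AddCommGroup M] [Module R M] (d n : ℕ)
    (hdim : ringKrullDim R = (d : WithBot (WithTop ℕ)))
    (hn : 2 * d ≤ n)
    (hvan : Subsingleton
      (extModule R n (ModuleCat.of R (resField R p)) (ModuleCat.of R M))) :
    ∀ i : ℕ, n ≤ i →
      Subsingleton (extModule R i (ModuleCat.of R (resField R p)) (ModuleCat.of R M)) := by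
  intro i hi
  rw [subsingleton_extModule_iff_s2] at hvan ⊢
  exact ext_residueField_rigidity_of_localization p (ModuleCat.of R M) d hdim
    (subsingleton_ext_localization p (ModuleCat.of R M) d hdim) hn hvan hi
end
end
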